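/- arXiv:2209.10799 — 3 statements merged into one kernel-verified Lean document; each statement's English description precedes it below -/
import Mathlib

section
/- Let B = {u_1,…,u_m} be a finite sortable set of monomials in S = K[x_1,…,x_n], where K is a field, and let A = K[u_1 t,…,u_m t] be the K-subalgebra of S[t] generated by the elements u_1 t,…,u_m t. Then A is an integral domain which is integrally closed in its field of fractions (i.e., A is a normal domain). -/
/-!
Monomials in `S = K[x_1, …, x_n]` are identified with multisets of (here, natural-number)
indices. -/

/-- Split a list into the sublist of entries in odd positions (1st, 3rd, 5th, …)
and the sublist of entries in even positions (2nd, 4th, …). -/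
def altSplit {α : Type*} : List α → List α × List α
  | [] => ([], [])
  | a :: l => (a :: (altSplit l).2, (altSplit l).1)

/-- The sorting `sort(u,v)` of a pair of monomials: write the product `u*v` as
`x_{i_1} x_{i_2} ⋯ x_{i_t}` with `i_1 ≤ i_2 ≤ ⋯ ≤ i_t`; then `u'` is the product of the
variables in odd positions and `v'` the product of those in even positions. -/
def sortPair {α : Type*} [LinearOrder α] (u v : Multiset α) : Multiset α × Multiset α :=
  (((altSplit ((u + v).sort (· ≤ ·))).1 : List α), ((altSplit ((u + v).sort (· ≤ ·))).2 : List α))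

/-- A pair of monomials is sorted if `sort(u,v) = (u,v)`. -/
def IsSortedPair {α : Type*} [LinearOrder α] (u v : Multiset α) : Prop :=
  sortPair u v = (u, v)

/-- A `q`-tuple of monomials is sorted if `(u_i, u_j)` is a sorted pair for all `i < j`. -/
def IsSortedTuple {α : Type*} [LinearOrder α] {q : ℕ} (u : Fin q → Multiset α) : Prop :=
  ∀ i j : Fin q, i < j → IsSortedPair (u i) (u j)

/-- A `q`-tuple of monomials is sorted of type `(d,r)` if it is sorted, its first `r` entries
have degree `d+1` and the remaining entries have degree `d`. -/
def IsSortedOfType {α : Type*} [LinearOrder α] {q : ℕ} (u : Fin q → Multiset α)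
    (d r : ℕ) : Prop :=
  IsSortedTuple u ∧ ∀ i : Fin q, Multiset.card (u i) = if (i : ℕ) < r then d + 1 else d

theorem aux_intClosed {K P : Type*} [Field K] [CommRing P] [IsDomain P] [Algebra K P]
    [IsIntegrallyClosed P] (A : Subalgebra K P)
    (h : ∀ f : P, IsAlmostIntegral A f → f ∈ A) : IsIntegrallyClosed A := by
  let F := FractionRing A
  let L := FractionRing P
  have hAP : Function.Injective (algebraMap A L) := by
    rw [IsScalarTower.algebraMap_eq A P L]
    exact (IsFractionRing.injective P L).comp Subtype.val_injective
  have : FaithfulSMul A L := (faithfulSMul_iff_algebraMap_injective A L).2 hAP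
  let : Algebra F L := FractionRing.liftAlgebra A L
  have : IsScalarTower A F L := FractionRing.isScalarTower_liftAlgebra A L
  rw [isIntegrallyClosed_iff F]
  intro x hx
  have h1 : IsIntegral A (algebraMap F L x) := hx.algebraMap
  have h2 : IsIntegral P (algebraMap F L x) := h1.tower_top
  obtain ⟨f, hf⟩ := IsIntegrallyClosed.isIntegral_iff.1 h2
  obtain ⟨r, hr, hr'⟩ := hx.isAlmostIntegral
  have h3 : IsAlmostIntegral A f := by
    refine ⟨r, hr, fun n => ?_⟩
    obtain ⟨a, ha⟩ := hr' n
    refine ⟨a, ?_⟩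
    apply IsFractionRing.injective P L
    have := congrArg (algebraMap F L) ha
    rw [← IsScalarTower.algebraMap_apply, Algebra.smul_def, map_mul, map_pow,
      ← IsScalarTower.algebraMap_apply, ← hf] at this
    rw [← IsScalarTower.algebraMap_apply, this, Algebra.smul_def, map_mul, map_pow,
      ← IsScalarTower.algebraMap_apply]
  refine ⟨⟨f, h f h3⟩, ?_⟩
  apply (algebraMap F L).injective
  rw [← hf, ← IsScalarTower.algebraMap_apply, IsScalarTower.algebraMap_apply A P L]
  rfl

open MvPolynomial in
theorem aux_mem_adjoin {σ ι K : Type*} [Field K] (e : ι → σ →₀ ℕ) (f : MvPolynomial σ K) :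
    f ∈ Algebra.adjoin K (Set.range fun i => monomial (e i) (1 : K)) ↔
      ∀ w ∈ f.support, w ∈ AddSubmonoid.closure (Set.range e) := by
  classical
  constructor
  · intro hf
    induction hf using Algebra.adjoin_induction with
    | mem x hx =>
      obtain ⟨i, rfl⟩ := hx
      intro w hw
      have := support_monomial_subset hw
      rw [Finset.mem_singleton] at this
      subst this
      exact AddSubmonoid.subset_closure ⟨i, rfl⟩
    | algebraMap r =>
      intro w hw
      rw [MvPolynomial.algebraMap_eq, MvPolynomial.mem_support_iff, MvPolynomial.coeff_C] at hw
      have : w = 0 := by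
        by_contra h
        exact hw (if_neg (Ne.symm h))
      subst this
      exact zero_mem _
    | add x y _ _ hx hy =>
      intro w hw
      rcases Finset.mem_union.1 (support_add hw) with h | h
      · exact hx w h
      · exact hy w h
    | mul x y _ _ hx hy =>
      intro w hw
      obtain ⟨a, ha, b, hb, rfl⟩ := Finset.mem_add.1 (support_mul x y hw)
      exact add_mem (hx a ha) (hy b hb)
  · intro h
    rw [f.as_sum]
    refine sum_mem fun w hw => ?_
    have h1 : monomial w (1 : K) ∈
        Algebra.adjoin K (Set.range fun i => monomial (e i) (1 : K)) := by
      have := h w hw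
      clear hw
      induction this using AddSubmonoid.closure_induction with
      | mem x hx =>
        obtain ⟨i, rfl⟩ := hx
        exact Algebra.subset_adjoin ⟨i, rfl⟩
      | zero => exact one_mem _
      | add x y _ _ hx hy =>
        have := mul_mem hx hy
        rwa [monomial_mul, one_mul] at this
    have := Subalgebra.smul_mem _ h1 (coeff w f)
    rwa [smul_monomial, smul_eq_mul, mul_one] at this

/-- Dickson argument. -/
theorem aux_dickson {σ ι : Type*} [Fintype ι] (e : ι → σ →₀ ℕ) (a w : σ →₀ ℕ)
    (h : ∀ k : ℕ, a + k • w ∈ AddSubmonoid.closure (Set.range e)) :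
    ∃ k : ℕ, 0 < k ∧ k • w ∈ AddSubmonoid.closure (Set.range e) := by
  classical
  have h1 : ∀ k : ℕ, ∃ c : ι → ℕ, ∑ i, c i • e i = a + k • w := by
    intro k
    have := h k
    rw [AddSubmonoid.mem_closure_range_iff_of_fintype] at this
    obtain ⟨c, hc⟩ := this
    exact ⟨c, hc.symm⟩
  choose c hc using h1
  obtain ⟨k, l, hkl, hle⟩ := wellQuasiOrdered_le (α := ι → ℕ) c
  refine ⟨l - k, by omega, ?_⟩
  have : (l - k) • w = ∑ i, (c l i - c k i) • e i := by
    have h2 : (a + k • w) + ∑ i, (c l i - c k i) • e i = (a + k • w) + (l - k) • w := by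
      have h3 : (a + k • w) + (l - k) • w = a + l • w := by
        rw [add_assoc, ← add_nsmul, Nat.add_sub_cancel' hkl.le]
      rw [h3, ← hc k, ← hc l, ← Finset.sum_add_distrib]
      refine Finset.sum_congr rfl fun i _ => ?_
      rw [← add_nsmul, Nat.add_sub_cancel' (hle i)]
    exact (add_left_cancel h2).symm
  rw [this]
  exact sum_mem fun i _ => nsmul_mem (AddSubmonoid.subset_closure (Set.mem_range_self i)) _

open MvPolynomial in
theorem aux_alg {N : ℕ} {ι K : Type*} [Field K] [Fintype ι] (e : ι → Fin N →₀ ℕ)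
    (hsat : ∀ (k : ℕ) (w : Fin N →₀ ℕ), 0 < k → k • w ∈ AddSubmonoid.closure (Set.range e) →
      w ∈ AddSubmonoid.closure (Set.range e)) :
    IsIntegrallyClosed (Algebra.adjoin K (Set.range fun i => monomial (e i) (1 : K))) := by
  classical
  apply aux_intClosed
  set A := Algebra.adjoin K (Set.range fun i => monomial (e i) (1 : K)) with hA
  let o : MonomialOrder (Fin N) := MonomialOrder.lex
  have key : ∀ f : MvPolynomial (Fin N) K, f ≠ 0 → IsAlmostIntegral A f →
      o.degree f ∈ AddSubmonoid.closure (Set.range e) := by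
    intro f hf ⟨r, hr, hr'⟩
    have hr0 : (r : MvPolynomial (Fin N) K) ≠ 0 := by
      have := nonZeroDivisors.ne_zero hr
      simpa using this
    obtain ⟨k, hk, hk'⟩ := aux_dickson e (o.degree (r : MvPolynomial (Fin N) K)) (o.degree f) (by
      intro k
      obtain ⟨b, hb⟩ := hr' k
      rw [← o.degree_pow, ← o.degree_mul hr0 (pow_ne_zero _ hf)]
      refine (aux_mem_adjoin e ((r : MvPolynomial (Fin N) K) * f ^ k)).1 ?_ _
        (o.degree_mem_support (mul_ne_zero hr0 (pow_ne_zero _ hf)))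
      have : (r : MvPolynomial (Fin N) K) * f ^ k = b := hb.symm
      rw [this]
      exact b.2)
    exact hsat k _ hk hk'
  suffices H : ∀ (d : ℕ) (f : MvPolynomial (Fin N) K), f.support.card = d →
      f ∈ completeIntegralClosure A (MvPolynomial (Fin N) K) → f ∈ A from
    fun f hf => H _ f rfl hf
  intro d
  induction d with
  | zero =>
    intro f hf _
    rw [Finset.card_eq_zero, MvPolynomial.support_eq_empty] at hf
    subst hf
    exact zero_mem _
  | succ d ih =>
    intro f hf hfi
    have hf0 : f ≠ 0 := by rintro rfl; simp at hf
    have h1 := key f hf0 hfi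
    have h2 : monomial (o.degree f) (coeff (o.degree f) f) ∈ A := by
      refine (aux_mem_adjoin e _).2 fun w hw => ?_
      have := support_monomial_subset hw
      rw [Finset.mem_singleton] at this
      subst this
      exact h1
    have h3 : f - monomial (o.degree f) (coeff (o.degree f) f) ∈ A := by
      apply ih
      · have : (f - monomial (o.degree f) (coeff (o.degree f) f)).support
            = f.support.erase (o.degree f) := by
          ext w
          simp only [MvPolynomial.mem_support_iff, coeff_sub, coeff_monomial, Finset.mem_erase]
          by_cases h : w = o.degree f
          · simp [h]
          · simp [h, Ne.symm h]
        rw [this, Finset.card_erase_of_mem (o.degree_mem_support hf0), hf]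
        rfl
      · exact sub_mem hfi (Subalgebra.algebraMap_mem _ (⟨_, h2⟩ : A))
    have := add_mem h3 h2
    rwa [sub_add_cancel] at this

theorem aux_sum_update {α : Type*} {N : ℕ} (g : Fin N → α → ℕ) (v : Fin N → α) (i j : Fin N)
    (hij : i ≠ j) (k l : α) :
    ∑ x, g x (Function.update (Function.update v i k) j l x) + (g i (v i) + g j (v j))
      = ∑ x, g x (v x) + (g i k + g j l) := by
  have hi : i ∈ (Finset.univ.erase j : Finset (Fin N)) := by simp [hij]
  rw [← Finset.add_sum_erase _ _ (Finset.mem_univ j), ← Finset.add_sum_erase _ _ hi,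
    ← Finset.add_sum_erase _ (fun x => g x (v x)) (Finset.mem_univ j),
    ← Finset.add_sum_erase _ (fun x => g x (v x)) hi]
  have : ∑ x ∈ (Finset.univ.erase j).erase i,
      g x (Function.update (Function.update v i k) j l x)
      = ∑ x ∈ (Finset.univ.erase j).erase i, g x (v x) := by
    refine Finset.sum_congr rfl fun x hx => ?_
    simp only [Finset.mem_erase, Finset.mem_univ, and_true] at hx
    rw [Function.update_of_ne hx.2, Function.update_of_ne hx.1]
  rw [this]
  simp only [Function.update_self, Function.update_of_ne hij]
  ring

theorem aux_step (N i j a b : ℕ) (hij : i < j) (hj : j < N) (h : ¬ (b ≤ a ∧ a ≤ b + 1)) :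
    (N * ((a + b + 1) / 2) ^ 2 + 2 * i * ((a + b + 1) / 2)) +
      (N * ((a + b) / 2) ^ 2 + 2 * j * ((a + b) / 2))
    < (N * a ^ 2 + 2 * i * a) + (N * b ^ 2 + 2 * j * b) := by
  obtain ⟨a', ha'⟩ : ∃ a', a' = (a + b + 1) / 2 := ⟨_, rfl⟩
  obtain ⟨b', hb'⟩ : ∃ b', b' = (a + b) / 2 := ⟨_, rfl⟩
  rw [← ha', ← hb']
  by_cases hab : b ≤ a
  · obtain ⟨t, ht⟩ : ∃ t, a = a' + t := ⟨a - a', by omega⟩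
    have h2 : b' = b + t := by omega
    have h1 : 1 ≤ t := by omega
    have h3 : b' ≤ a' := by omega
    subst ht h2
    obtain ⟨d, rfl⟩ := Nat.exists_eq_add_of_le h3
    zify at *
    have : (0 : ℤ) < t * (N * (t + d) - (j - i)) := by
      apply mul_pos (by omega)
      have : (N : ℤ) * 1 ≤ N * (t + d) := by
        apply mul_le_mul_of_nonneg_left <;> omega
      omega
    nlinarith
  · obtain ⟨t, ht⟩ : ∃ t, a' = a + t := ⟨a' - a, by omega⟩
    have h2 : b = b' + t := by omega
    have h1 : 1 ≤ t := by omega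
    have h3 : a ≤ b' := by omega
    subst ht h2
    obtain ⟨d, rfl⟩ := Nat.exists_eq_add_of_le h3
    zify at *
    have : (0 : ℤ) < t * (N * d + (j - i)) := by
      apply mul_pos (by omega)
      have : (0 : ℤ) ≤ N * d := by positivity
      omega
    nlinarith

theorem aux_balance {m n N : ℕ} (C : Fin m → Fin n → ℕ)
    (hC : ∀ i j, ∃ k l, ∀ s, C k s = (C i s + C j s + 1) / 2 ∧ C l s = (C i s + C j s) / 2)
    (v : Fin N → Fin m) : ∃ v' : Fin N → Fin m, (∀ s, ∑ j, C (v' j) s = ∑ j, C (v j) s) ∧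
      ∀ i j, i < j → ∀ s, C (v' j) s ≤ C (v' i) s ∧ C (v' i) s ≤ C (v' j) s + 1 := by
  let g : Fin N → Fin m → ℕ := fun x b => ∑ s, (N * (C b s) ^ 2 + 2 * (x : ℕ) * C b s)
  obtain ⟨d, hd⟩ : ∃ d, d = ∑ x, g x (v x) := ⟨_, rfl⟩
  induction d using Nat.strong_induction_on generalizing v with
  | _ d ih =>
    by_cases H : ∀ i j, i < j → ∀ s, C (v j) s ≤ C (v i) s ∧ C (v i) s ≤ C (v j) s + 1
    · exact ⟨v, fun _ => rfl, H⟩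
    · push Not at H
      obtain ⟨i, j, hij, s, hs⟩ := H
      obtain ⟨k, l, hkl⟩ := hC (v i) (v j)
      have hlt : g i k + g j l < g i (v i) + g j (v j) := by
        simp only [g]
        rw [← Finset.sum_add_distrib, ← Finset.sum_add_distrib]
        apply Finset.sum_lt_sum
        · intro s _
          rw [(hkl s).1, (hkl s).2]
          by_cases hh : C (v j) s ≤ C (v i) s ∧ C (v i) s ≤ C (v j) s + 1
          · rw [show (C (v i) s + C (v j) s + 1) / 2 = C (v i) s by omega,
              show (C (v i) s + C (v j) s) / 2 = C (v j) s by omega]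
          · exact (aux_step N i j _ _ hij j.2 hh).le
        · refine ⟨s, Finset.mem_univ _, ?_⟩
          rw [(hkl s).1, (hkl s).2]
          exact aux_step N i j _ _ hij j.2 (fun hh => by have := hs hh.1; omega)
      have h1 := aux_sum_update g v i j hij.ne k l
      obtain ⟨v', hv1, hv2⟩ := ih _ (by omega)
        (Function.update (Function.update v i k) j l) rfl
      refine ⟨v', fun s => ?_, hv2⟩
      rw [hv1 s]
      have h2 := aux_sum_update (fun _ b => C b s) v i j hij.ne k l
      have := hkl s
      omega

theorem aux_range_mul (c : ℕ → ℕ) (k q : ℕ) :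
    ∑ j ∈ Finset.range (k * q), c j
      = ∑ r ∈ Finset.range k, ∑ j ∈ Finset.range q, c (k * j + r) := by
  rw [Finset.sum_comm]
  induction q with
  | zero => simp
  | succ q ih => rw [Nat.mul_succ, Finset.sum_range_add, ih, Finset.sum_range_succ]

theorem aux_thin (c : ℕ → ℕ) (k q T : ℕ) (hk : 0 < k)
    (hc : ∀ i j, i < j → j < k * q → c j ≤ c i ∧ c i ≤ c j + 1)
    (hT : ∑ j ∈ Finset.range (k * q), c j = k * T) :
    ∑ j ∈ Finset.range q, c (k * j) = T := by
  have hc' : ∀ i j, i ≤ j → j < k * q → c j ≤ c i ∧ c i ≤ c j + 1 := by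
    intro i j hij hj
    rcases hij.eq_or_lt with rfl | h
    · omega
    · exact hc i j h hj
  rw [aux_range_mul] at hT
  obtain ⟨S, hS⟩ : ∃ S, S = ∑ j ∈ Finset.range q, c (k * j) := ⟨_, rfl⟩
  rw [← hS]
  have up : ∀ r ∈ Finset.range k, ∑ j ∈ Finset.range q, c (k * j + r) ≤ S := by
    intro r hr
    rw [hS]
    refine Finset.sum_le_sum fun j hj => ?_
    rw [Finset.mem_range] at hr hj
    refine (hc' _ _ (by omega) ?_).1
    nlinarith
  have lo : ∀ r ∈ Finset.range k, S ≤ ∑ j ∈ Finset.range q, c (k * j + r) + 1 := by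
    intro r hr
    rw [Finset.mem_range] at hr
    rw [hS]
    cases q with
    | zero => simp
    | succ Q =>
      rw [Finset.sum_range_succ', Finset.sum_range_succ]
      have h1 : ∑ j ∈ Finset.range Q, c (k * (j + 1)) ≤ ∑ j ∈ Finset.range Q, c (k * j + r) := by
        refine Finset.sum_le_sum fun j hj => ?_
        rw [Finset.mem_range] at hj
        refine (hc' _ _ ?_ ?_).1
        · rw [Nat.mul_succ]; omega
        · nlinarith
      have h2 := (hc' (k * 0) (k * Q + r) (by omega) (by rw [Nat.mul_succ]; omega)).2
      omega
  obtain ⟨K, rfl⟩ : ∃ K, k = K + 1 := ⟨k - 1, by omega⟩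
  have h1 := Finset.sum_le_sum up
  rw [hT, Finset.sum_const, Finset.card_range, smul_eq_mul] at h1
  have h1' : T ≤ S := Nat.le_of_mul_le_mul_left h1 hk
  rw [Finset.sum_range_succ'] at hT
  have h2 : ∑ r ∈ Finset.range K, S
      ≤ ∑ r ∈ Finset.range K, (∑ j ∈ Finset.range q, c ((K + 1) * j + (r + 1)) + 1) :=
    Finset.sum_le_sum fun r hr => lo (r + 1) (by simp at hr ⊢; omega)
  rw [Finset.sum_add_distrib] at h2
  simp only [Finset.sum_const, Finset.card_range, smul_eq_mul, mul_one, add_zero] at h2 hT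
  rw [← hS] at hT
  apply le_antisymm _ h1'
  by_contra hlt
  have : (K + 1) * (T + 1) ≤ (K + 1) * S := Nat.mul_le_mul_left _ (by omega)
  nlinarith

theorem aux_tuple {m n k q : ℕ} (hk : 0 < k) (C : Fin m → Fin n → ℕ)
    (hC : ∀ i j, ∃ k l, ∀ s, C k s = (C i s + C j s + 1) / 2 ∧ C l s = (C i s + C j s) / 2)
    (T : Fin n → ℕ) (v : Fin (k * q) → Fin m) (hv : ∀ s, ∑ j, C (v j) s = k * T s) :
    ∃ v' : Fin q → Fin m, ∀ s, ∑ j, C (v' j) s = T s := by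
  obtain ⟨w, hw1, hw2⟩ := aux_balance C hC v
  have hlt : ∀ j : Fin q, k * (j : ℕ) < k * q := fun j => Nat.mul_lt_mul_of_pos_left j.2 hk
  refine ⟨fun j => w ⟨k * j, hlt j⟩, fun s => ?_⟩
  let c : ℕ → ℕ := fun j => if h : j < k * q then C (w ⟨j, h⟩) s else 0
  have := aux_thin c k q (T s) hk (by
      intro i j hij hj
      simp only [c, hj, hij.trans hj, dite_true]
      exact hw2 _ _ hij s) (by
      rw [Finset.sum_range, ← hv s, ← hw1 s]
      refine Finset.sum_congr rfl fun j _ => ?_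
      simp [c])
  rw [← this, Finset.sum_range]
  refine Finset.sum_congr rfl fun j _ => ?_
  simp only [c, hlt j, dite_true]

theorem aux_altSplit {α : Type*} [LinearOrder α] (s : α) (l : List α)
    (hl : l.Pairwise (· ≤ ·)) :
    (altSplit l).1.countP (· ≤ s) = (l.countP (· ≤ s) + 1) / 2 ∧
    (altSplit l).2.countP (· ≤ s) = l.countP (· ≤ s) / 2 := by
  induction l with
  | nil => simp [altSplit]
  | cons a l ih =>
    rw [List.pairwise_cons] at hl
    obtain ⟨h1, h2⟩ := ih hl.2
    simp only [altSplit, List.countP_cons, h1, h2]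
    by_cases h : a ≤ s
    · rw [if_pos (by simpa using h)]
      constructor <;> omega
    · have : l.countP (· ≤ s) = 0 := by
        rw [List.countP_eq_zero]
        intro b hb hbs
        exact h ((hl.1 b hb).trans (by simpa using hbs))
      simp [h, this]

theorem aux_sortPair {α : Type*} [LinearOrder α] (s : α) (u v u' v' : Multiset α)
    (h : sortPair u v = (u', v')) :
    u'.countP (· ≤ s) = (u.countP (· ≤ s) + v.countP (· ≤ s) + 1) / 2 ∧
    v'.countP (· ≤ s) = (u.countP (· ≤ s) + v.countP (· ≤ s)) / 2 := by
  have h1 := aux_altSplit s ((u + v).sort (· ≤ ·)) (Multiset.pairwise_sort _ _)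
  have h2 : ((u + v).sort (· ≤ ·)).countP (· ≤ s) = u.countP (· ≤ s) + v.countP (· ≤ s) := by
    rw [← Multiset.countP_add, ← Multiset.coe_countP, Multiset.sort_eq]
  rw [h2] at h1
  unfold sortPair at h
  rw [Prod.mk.injEq] at h
  rw [← h.1, ← h.2, Multiset.coe_countP, Multiset.coe_countP]
  exact h1

theorem aux_count {n : ℕ} (X : Multiset (Fin n)) (x : Fin n) :
    X.countP (· ≤ x) = X.countP (· < x) + X.count x := by
  induction X using Multiset.induction with
  | empty => simp
  | cons a X ih =>
    rw [Multiset.countP_cons, Multiset.countP_cons, Multiset.count_cons, ih]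
    rcases lt_trichotomy a x with h | h | h
    · simp [h, h.le, h.ne']; omega
    · simp [h]; omega
    · simp [h.not_ge, h.ne, h.not_gt]

theorem aux_ext {n : ℕ} (X Y : Multiset (Fin n))
    (h : ∀ s, X.countP (· ≤ s) = Y.countP (· ≤ s)) : X = Y := by
  ext x
  have h1 := aux_count X x
  have h2 := aux_count Y x
  have h3 : X.countP (· < x) = Y.countP (· < x) := by
    by_cases hx : (x : ℕ) = 0
    · have : ∀ Z : Multiset (Fin n), Z.countP (· < x) = 0 := by
        intro Z
        rw [Multiset.countP_eq_zero]
        intro a _ ha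
        have : (a : ℕ) < x := ha
        omega
      rw [this, this]
    · have : ∀ Z : Multiset (Fin n), Z.countP (· < x)
          = Z.countP (· ≤ (⟨x - 1, by omega⟩ : Fin n)) := by
        intro Z
        apply Multiset.countP_congr rfl
        intro a _
        simp only [Fin.lt_def, Fin.le_def, eq_iff_iff]
        omega
      rw [this, this, h]
  have := h x
  omega

theorem aux_exists_tuple {ι M : Type*} [AddCommMonoid M] (e : ι → M) (x : M)
    (hx : x ∈ AddSubmonoid.closure (Set.range e)) :
    ∃ (N : ℕ) (v : Fin N → ι), ∑ j, e (v j) = x := by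
  obtain ⟨l, hl, rfl⟩ := AddSubmonoid.exists_list_of_mem_closure hx
  choose v hv using fun j : Fin l.length => hl l[j] (List.getElem_mem _)
  refine ⟨l.length, v, ?_⟩
  simp only [hv]
  simp

noncomputable def auxExp {n : ℕ} (u : Multiset (Fin n)) : Fin (n + 1) →₀ ℕ :=
  Finsupp.cons 1 (Multiset.toFinsupp u)

theorem aux_sat (n m : ℕ) (u : Fin m → Multiset (Fin n))
    (hsort : ∀ i j : Fin m, ∃ k l : Fin m, sortPair (u i) (u j) = (u k, u l))
    (k : ℕ) (w : Fin (n + 1) →₀ ℕ) (hk : 0 < k)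
    (hw : k • w ∈ AddSubmonoid.closure (Set.range fun i => auxExp (u i))) :
    w ∈ AddSubmonoid.closure (Set.range fun i => auxExp (u i)) := by
  obtain ⟨N, v, hv⟩ := aux_exists_tuple _ _ hw
  have hN : N = k * w 0 := by
    have := DFunLike.congr_fun hv 0
    simpa [auxExp, Finsupp.finsetSum_apply] using this
  subst hN
  let a : Multiset (Fin n) := Finsupp.toMultiset (Finsupp.tail w)
  have hca : ∀ x, a.count x = w x.succ := by
    intro x
    simp [a, Finsupp.count_toMultiset, Finsupp.tail_apply]
  have ha : ∑ j, u (v j) = k • a := by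
    ext x
    have := DFunLike.congr_fun hv x.succ
    rw [Multiset.count_sum', Multiset.count_nsmul, hca]
    simpa [auxExp, Finsupp.finsetSum_apply] using this
  have hsum : ∀ (q : ℕ) (v : Fin q → Fin m) (s : Fin n),
      ∑ j, (u (v j)).countP (· ≤ s) = (∑ j, u (v j)).countP (· ≤ s) := by
    intro q v s
    exact (map_sum (Multiset.countPAddMonoidHom (· ≤ s)) _ _).symm
  obtain ⟨v', hv'⟩ := aux_tuple hk (fun i s => (u i).countP (· ≤ s)) (by
      intro i j
      obtain ⟨k, l, h⟩ := hsort i j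
      exact ⟨k, l, fun s => aux_sortPair s _ _ _ _ h⟩) (fun s => a.countP (· ≤ s)) v (by
      intro s
      rw [hsum, ha, Multiset.countP_nsmul])
  have hva : ∑ j, u (v' j) = a := by
    apply aux_ext
    intro s
    rw [← hsum]
    exact hv' s
  have : w = ∑ j, auxExp (u (v' j)) := by
    ext x
    rw [Finsupp.finsetSum_apply]
    refine Fin.cases ?_ (fun x => ?_) x
    · simp [auxExp]
    · rw [← hca, ← hva, Multiset.count_sum']
      simp [auxExp]
  rw [this]
  exact sum_mem fun j _ => AddSubmonoid.subset_closure ⟨_, rfl⟩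

theorem aux_monomial {n : ℕ} (K : Type*) [Field K] (u : Multiset (Fin n)) :
    MvPolynomial.finSuccEquiv K n (MvPolynomial.monomial (auxExp u) 1)
      = Polynomial.C ((u.map MvPolynomial.X).prod) * Polynomial.X := by
  have : MvPolynomial.monomial (auxExp u) (1 : K)
      = (u.map fun i => MvPolynomial.X (Fin.succ i)).prod * MvPolynomial.X 0 := by
    induction u using Multiset.induction with
    | empty =>
      rw [Multiset.map_zero, Multiset.prod_zero, one_mul, MvPolynomial.X]
      refine congrArg (fun w => MvPolynomial.monomial w (1 : K)) (Finsupp.ext fun x => ?_)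
      refine Fin.cases ?_ (fun x => ?_) x
      · simp [auxExp]
      · simp [auxExp]
    | cons a u ih =>
      rw [Multiset.map_cons, Multiset.prod_cons, mul_assoc, ← ih, MvPolynomial.X,
        MvPolynomial.monomial_mul, one_mul]
      refine congrArg (fun w => MvPolynomial.monomial w (1 : K)) (Finsupp.ext fun x => ?_)
      refine Fin.cases ?_ (fun x => ?_) x
      · simp [auxExp]
      · simp [auxExp, Multiset.count_cons, Finsupp.single_apply, add_comm, eq_comm]
  rw [this, map_mul, MvPolynomial.finSuccEquiv_X_zero, map_multiset_prod, map_multiset_prod,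
    Multiset.map_map, Multiset.map_map]
  simp only [Function.comp_def, MvPolynomial.finSuccEquiv_X_succ]

/-- let `B = {u_1,…,u_m}` be a finite sortable set of monomials in
`S = K[x_1,…,x_n]` and `A = K[u_1 t, …, u_m t] ⊆ S[t]`.  Then `A` is a normal domain,
i.e. an integral domain which is integrally closed in its field of fractions. -/
theorem toric_ring_of_sortable_is_normal_domain
    (n m : ℕ) (K : Type*) [Field K]
    (u : Fin m → Multiset (Fin n)) (hinj : Function.Injective u)
    (hsort : ∀ i j : Fin m, ∃ k l : Fin m, sortPair (u i) (u j) = (u k, u l))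
    (A : Subalgebra K (Polynomial (MvPolynomial (Fin n) K)))
    (hA : A = Algebra.adjoin K (Set.range (fun i : Fin m =>
      Polynomial.C (((u i).map MvPolynomial.X).prod) * Polynomial.X))) :
    IsDomain A ∧ IsIntegrallyClosed A := by
  refine ⟨inferInstance, ?_⟩
  have h1 := aux_alg (K := K) (fun i => auxExp (u i)) (aux_sat n m u hsort)
  have h2 : A = (Algebra.adjoin K (Set.range fun i =>
      MvPolynomial.monomial (auxExp (u i)) (1 : K))).map
        (MvPolynomial.finSuccEquiv K n : _ →ₐ[K] _) := by
    rw [AlgHom.map_adjoin, hA, ← Set.range_comp]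
    congr 2
    funext i
    exact (aux_monomial K (u i)).symm
  subst h2
  exact IsIntegrallyClosed.of_equiv (Subalgebra.equivMapOfInjective _ _
    (MvPolynomial.finSuccEquiv K n).injective).toRingEquiv
end

section
/- Let G be a proper interval graph on vertex set [n] = {1,…,n} and K a field. Then the vertex cover algebra of G, namely the K-subalgebra K[x_C t : C a minimal vertex cover of G] of the polynomial ring K[x_1,…,x_n,t], is an integral domain which is integrally closed in its field of fractions (i.e., a normal domain). -/
/-- `C` is a vertex cover of the graph `G`: it meets every edge. -/
def IsVertexCover {W : Type*} (G : SimpleGraph W) (C : Finset W) : Prop :=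
  ∀ a b : W, G.Adj a b → a ∈ C ∨ b ∈ C

/-- `C` is a minimal vertex cover of `G`: it is a vertex cover and no proper subset of `C`
is a vertex cover. -/
def IsMinVertexCover {W : Type*} (G : SimpleGraph W) (C : Finset W) : Prop :=
  IsVertexCover G C ∧ ∀ D : Finset W, D ⊆ C → IsVertexCover G D → D = C

/-- `G` is a proper interval graph (with respect to the labeling of its vertices by `Fin n`):
for all `i < j` with `{i,j}` an edge, the induced subgraph on `{i, i+1, …, j}` is complete. -/
def IsProperInterval {n : ℕ} (G : SimpleGraph (Fin n)) : Prop :=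
  ∀ i j : Fin n, i < j → G.Adj i j →
    ∀ a b : Fin n, i ≤ a → a ≤ j → i ≤ b → b ≤ j → a ≠ b → G.Adj a b

section VCC

lemma vcc_slot (F : ℕ → ℕ) (p l r : ℕ) (hlr : l ≤ r) (h1 : F l ≤ p) (h2 : p < F r) :
    ∃ i, l ≤ i ∧ i < r ∧ F i ≤ p ∧ p < F (i + 1) := by
  induction r, hlr using Nat.le_induction with
  | base => omega
  | succ r hr ih =>
    by_cases h : p < F r
    · obtain ⟨i, h⟩ := ih h
      exact ⟨i, h.1, by omega, h.2.2⟩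
    · exact ⟨r, hr, by omega, by omega, h2⟩

open Classical in
lemma vcc_count (k s a : ℕ) (ha : a ≤ k) :
    ((Finset.range k).filter (fun c => ∃ p, s ≤ p ∧ p < s + a ∧ p % k = c)).card = a := by
  have : (Finset.range k).filter (fun c => ∃ p, s ≤ p ∧ p < s + a ∧ p % k = c) =
      (Finset.Ico s (s + a)).image (· % k) := by
    ext c
    simp only [Finset.mem_filter, Finset.mem_range, Finset.mem_image, Finset.mem_Ico]
    constructor
    · rintro ⟨_, p, h1, h2, h3⟩; exact ⟨p, ⟨h1, h2⟩, h3⟩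
    · rintro ⟨p, ⟨h1, h2⟩, h3⟩
      exact ⟨h3 ▸ Nat.mod_lt _ (by omega), p, h1, h2, h3⟩
  rw [this, Finset.card_image_of_injOn]
  · simp
  · intro p hp q hq hpq
    simp only [Finset.coe_Ico, Set.mem_Ico] at hp hq
    have hpq : p % k = q % k := hpq
    have e1 := Nat.div_add_mod p k
    have e2 := Nat.div_add_mod q k
    rcases lt_trichotomy (p / k) (q / k) with h | h | h
    · have := Nat.mul_le_mul_left k (Nat.succ_le_of_lt h)
      rw [Nat.mul_succ] at this; omega
    · rw [h] at e1; omega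
    · have := Nat.mul_le_mul_left k (Nat.succ_le_of_lt h)
      rw [Nat.mul_succ] at this; omega

/-- The combinatorial core: a vector satisfying the clique and closed-neighbourhood
inequalities is a sum of `k` maximal independent sets (complements of minimal covers). -/
lemma vcc_decomp {n : ℕ} (G : SimpleGraph (Fin n)) (hG : IsProperInterval G)
    (a : Fin n → ℕ) (k : ℕ)
    (h1 : ∀ Q : Finset (Fin n), (∀ x ∈ Q, ∀ y ∈ Q, x ≠ y → G.Adj x y) → ∑ i ∈ Q, a i ≤ k)
    (h2 : ∀ (z : Fin n) (N : Finset (Fin n)), (∀ i, i ∈ N ↔ i = z ∨ G.Adj i z) →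
      k ≤ ∑ i ∈ N, a i) :
    ∃ D : ℕ → Finset (Fin n), (∀ c < k, IsMinVertexCover G (D c)) ∧
      ∀ i, ((Finset.range k).filter (fun c => i ∈ D c)).card + a i = k := by
  classical
  let a' : ℕ → ℕ := fun m => if h : m < n then a ⟨m, h⟩ else 0
  have ha' : ∀ i : Fin n, a' i = a i := fun i => by simp [a']
  let F : ℕ → ℕ := fun m => ∑ i ∈ Finset.range m, a' i
  have hF : ∀ m, F (m + 1) = F m + a' m := fun m => Finset.sum_range_succ _ _
  have hFmono : Monotone F := monotone_nat_of_le_succ (fun m => by rw [hF]; omega)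
  have hIcc : ∀ i j : Fin n, i ≤ j → F i + ∑ x ∈ Finset.Icc i j, a x = F (j + 1) := by
    intro i j hij
    have e : ∑ x ∈ Finset.Icc i j, a x = ∑ m ∈ Finset.Ico (i : ℕ) (j + 1), a' m := by
      have := Finset.sum_map (Finset.Icc i j) Fin.valEmbedding a'
      rw [Fin.map_valEmbedding_Icc] at this
      rw [← Finset.sum_congr rfl (fun x _ => ha' x)]
      refine this.symm.trans (Finset.sum_congr ?_ fun _ _ => rfl)
      ext x
      simp only [Finset.mem_Icc, Finset.mem_Ico]
      omega
    have hij' : (i : ℕ) ≤ j + 1 := by have : (i : ℕ) ≤ j := hij; omega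
    rw [e]
    exact Finset.sum_range_add_sum_Ico _ hij'
  let I : ℕ → Fin n → Prop := fun c i => ∃ p, F i ≤ p ∧ p < F i + a i ∧ p % k = c
  have hak : ∀ i, a i ≤ k := fun i => by
    have := h1 {i} (by
      intro x hx y hy hxy
      simp only [Finset.mem_singleton] at hx hy
      exact absurd (hx.trans hy.symm) hxy)
    simpa using this
  have hind : ∀ c i j, i < j → G.Adj i j → I c i → I c j → False := by
    rintro c i j hij hadj ⟨p, p1, p2, p3⟩ ⟨q, q1, q2, q3⟩
    have hle := h1 (Finset.Icc i j) (by
      intro x hx y hy hxy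
      rw [Finset.mem_Icc] at hx hy
      exact hG i j hij hadj x y hx.1 hx.2 hy.1 hy.2 hxy)
    have hs := hIcc i j hij.le
    have hj := hF j
    have hi := hF i
    rw [ha'] at hj hi
    have hm : F (i + 1) ≤ F j := hFmono (by have : (i : ℕ) < j := hij; omega)
    have e1 := Nat.div_add_mod p k
    have e2 := Nat.div_add_mod q k
    have hpq : p / k ≤ q / k := Nat.div_le_div_right (by omega)
    rcases hpq.lt_or_eq with h | h
    · have := Nat.mul_le_mul_left k (Nat.succ_le_of_lt h)
      rw [Nat.mul_succ] at this; omega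
    · rw [h] at e1; omega
  have hhit : ∀ c < k, ∀ z, ∃ i, (i = z ∨ G.Adj i z) ∧ I c i := by
    intro c hc z
    let N : Finset (Fin n) := Finset.univ.filter (fun i => i = z ∨ G.Adj i z)
    have hN : ∀ i, i ∈ N ↔ i = z ∨ G.Adj i z := fun i => by simp [N]
    have hzN : z ∈ N := (hN z).2 (Or.inl rfl)
    have hne : N.Nonempty := ⟨z, hzN⟩
    let l := N.min' hne
    let r := N.max' hne
    have hlz : l ≤ z := N.min'_le z hzN
    have hzr : z ≤ r := N.le_max' z hzN
    have hlN := (hN l).1 (N.min'_mem hne)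
    have hrN := (hN r).1 (N.max'_mem hne)
    have hsub : N ⊆ Finset.Icc l r := fun i hi =>
      Finset.mem_Icc.2 ⟨N.min'_le i hi, N.le_max' i hi⟩
    have hsum : k ≤ ∑ i ∈ Finset.Icc l r, a i :=
      (h2 z N hN).trans (Finset.sum_le_sum_of_subset hsub)
    have hs := hIcc l r (hlz.trans hzr)
    have hin : ∀ i, l ≤ i → i ≤ r → i = z ∨ G.Adj i z := by
      intro i hli hir
      by_cases hiz : i = z
      · exact Or.inl hiz
      right
      rcases lt_or_gt_of_ne hiz with h | h
      · have hlz' : l < z := hli.trans_lt h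
        exact hG l z hlz' (hlN.resolve_left hlz'.ne) i z hli h.le hlz le_rfl hiz
      · have hzr' : z < r := h.trans_le hir
        exact hG z r hzr' (hrN.resolve_left hzr'.ne').symm i z h.le hir le_rfl hzr hiz
    obtain ⟨p, hp1, hp2, hp3⟩ : ∃ p, F l ≤ p ∧ p < F l + k ∧ p % k = c := by
      have e := Nat.div_add_mod (F l) k
      have hlt := Nat.mod_lt (F l) (show 0 < k by omega)
      by_cases h : F l % k ≤ c
      · refine ⟨k * (F l / k) + c, by omega, by omega, ?_⟩
        rw [Nat.mul_add_mod, Nat.mod_eq_of_lt hc]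
      · refine ⟨k * (F l / k + 1) + c, ?_, ?_, ?_⟩
        · rw [Nat.mul_succ]; omega
        · rw [Nat.mul_succ]; omega
        · rw [Nat.mul_add_mod, Nat.mod_eq_of_lt hc]
    have hlr : (l : ℕ) ≤ r + 1 := by have : (l : ℕ) ≤ r := hlz.trans hzr; omega
    obtain ⟨m, m1, m2, m3, m4⟩ := vcc_slot F p l (r + 1) hlr hp1 (by omega)
    have hmn : m < n := by have := r.2; omega
    refine ⟨⟨m, hmn⟩, hin _ (Fin.le_def.2 m1) (Fin.le_def.2 (by simp; omega)), p, m3, ?_, hp3⟩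
    have e1 := hF m
    have e2 : a' m = a ⟨m, hmn⟩ := ha' ⟨m, hmn⟩
    rw [e1, e2] at m4
    exact m4
  refine ⟨fun c => Finset.univ.filter (fun i => ¬ I c i), ?_, ?_⟩
  · intro c hc
    refine ⟨?_, ?_⟩
    · intro x y hxy
      simp only [Finset.mem_filter, Finset.mem_univ, true_and]
      by_contra hcon
      push Not at hcon
      rcases lt_or_gt_of_ne hxy.ne with h | h
      · exact hind c x y h hxy hcon.1 hcon.2
      · exact hind c y x h hxy.symm hcon.2 hcon.1
    · intro D hD hcov
      refine Finset.Subset.antisymm hD ?_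
      intro z hz
      by_contra hzD
      obtain ⟨i, hi, hI⟩ := hhit c hc z
      rcases hi with rfl | hi
      · exact (Finset.mem_filter.1 hz).2 hI
      · rcases hcov i z hi with h | h
        · exact (Finset.mem_filter.1 (hD h)).2 hI
        · exact hzD h
  · intro i
    have := vcc_count k (F i) (a i) (hak i)
    have h3 := Finset.card_filter_add_card_filter_not (s := Finset.range k) (fun c => I c i)
    simp only [Finset.mem_filter, Finset.mem_univ, true_and]
    rw [Finset.card_range] at h3
    have h4 : ((Finset.range k).filter (fun c => I c i)).card = a i := by
      rw [← this]
    omega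

lemma vcc_min {n : ℕ} (G : SimpleGraph (Fin n)) (C : Finset (Fin n)) (hC : IsMinVertexCover G C)
    (z : Fin n) : ∃ i, (i = z ∨ G.Adj i z) ∧ i ∉ C := by
  by_contra hcon
  push Not at hcon
  have := hC.2 (C.erase z) (Finset.erase_subset _ _) (by
    intro x y hxy
    by_cases hx : x = z
    · subst hx
      right
      exact Finset.mem_erase.2 ⟨hxy.ne', hcon y (Or.inr hxy.symm)⟩
    · by_cases hy : y = z
      · subst hy
        exact Or.inl (Finset.mem_erase.2 ⟨hx, hcon x (Or.inr hxy)⟩)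
      · simpa [hx, hy] using hC.1 x y hxy)
  have hz := hcon z (Or.inl rfl)
  rw [← this] at hz
  simp at hz

lemma vcc_clique {n : ℕ} (G : SimpleGraph (Fin n)) (C : Finset (Fin n)) (hC : IsVertexCover G C)
    (Q : Finset (Fin n)) (hQ : ∀ x ∈ Q, ∀ y ∈ Q, x ≠ y → G.Adj x y) :
    (Q \ C).card ≤ 1 := by
  rw [Finset.card_le_one]
  intro x hx y hy
  rw [Finset.mem_sdiff] at hx hy
  by_contra hxy
  rcases hC x y (hQ x hx.1 y hy.1 hxy) with h | h
  · exact hx.2 h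
  · exact hy.2 h
end VCC

section VCA
open LaurentPolynomial

/-- the weight of an exponent pair -/
def vcaWeight {n : ℕ} (w : Fin n → ℤ) (w0 : ℤ) (b : Fin n →₀ ℕ) (k : ℕ) : ℤ :=
  ∑ i, (b i : ℤ) * w i + k * w0

noncomputable def vcaPhi0 {n : ℕ} {K : Type*} [Field K] {B : Type*} [CommRing B]
    (e : Polynomial (MvPolynomial (Fin n) K) ≃+* B) (w : Fin n → ℤ) :
    MvPolynomial (Fin n) K →+* B[T;T⁻¹] :=
  MvPolynomial.eval₂Hom
    (LaurentPolynomial.C.comp (e.toRingHom.comp (Polynomial.C.comp MvPolynomial.C)))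
    (fun i => LaurentPolynomial.C (e (Polynomial.C (MvPolynomial.X i))) * T (w i))

noncomputable def vcaPhi {n : ℕ} {K : Type*} [Field K] {B : Type*} [CommRing B]
    (e : Polynomial (MvPolynomial (Fin n) K) ≃+* B) (w : Fin n → ℤ) (w0 : ℤ) :
    Polynomial (MvPolynomial (Fin n) K) →+* B[T;T⁻¹] :=
  Polynomial.eval₂RingHom (vcaPhi0 e w) (LaurentPolynomial.C (e Polynomial.X) * T w0)

lemma vca_prod_T {ι : Type*} {R : Type*} [CommRing R] (s : Finset ι) (f : ι → ℤ) :
    ∏ i ∈ s, (T (f i) : R[T;T⁻¹]) = T (∑ i ∈ s, f i) := by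
  classical
  induction s using Finset.induction_on with
  | empty => simp
  | insert a s ha ih => rw [Finset.prod_insert ha, Finset.sum_insert ha, ih, T_add]

lemma vcaPhi_monomial {n : ℕ} {K : Type*} [Field K] {B : Type*} [CommRing B]
    (e : Polynomial (MvPolynomial (Fin n) K) ≃+* B) (w : Fin n → ℤ) (w0 : ℤ)
    (b : Fin n →₀ ℕ) (k : ℕ) (c : K) :
    vcaPhi e w w0 (Polynomial.monomial k (MvPolynomial.monomial b c)) =
      LaurentPolynomial.C (e (Polynomial.monomial k (MvPolynomial.monomial b c))) *
        T (vcaWeight w w0 b k) := by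
  have h0 : vcaPhi0 e w (MvPolynomial.monomial b c) =
      LaurentPolynomial.C (e (Polynomial.C (MvPolynomial.monomial b c))) *
        T (∑ i, (b i : ℤ) * w i) := by
    rw [vcaPhi0, MvPolynomial.coe_eval₂Hom, MvPolynomial.eval₂_monomial, MvPolynomial.monomial_eq,
      Finsupp.prod_fintype _ _ (by simp), Finsupp.prod_fintype _ _ (by simp)]
    simp only [mul_pow, Finset.prod_mul_distrib, T_pow, vca_prod_T, map_mul, map_prod, map_pow,
      RingHom.comp_apply, mul_assoc, RingEquiv.toRingHom_eq_coe, RingHom.coe_coe]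
  rw [vcaPhi, Polynomial.coe_eval₂RingHom, Polynomial.eval₂_monomial, h0, mul_pow, T_pow,
    vcaWeight, T_add, ← Polynomial.C_mul_X_pow_eq_monomial]
  simp only [map_mul, map_pow]
  ring

lemma vcaPhi_coeff {n : ℕ} {K : Type*} [Field K] {B : Type*} [CommRing B]
    (e : Polynomial (MvPolynomial (Fin n) K) ≃+* B) (w : Fin n → ℤ) (w0 : ℤ)
    (b : Fin n →₀ ℕ) (k : ℕ) (h : Polynomial (MvPolynomial (Fin n) K)) :
    MvPolynomial.coeff b ((e.symm ((vcaPhi e w w0 h).coeff (vcaWeight w w0 b k))).coeff k) =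
      MvPolynomial.coeff b (h.coeff k) := by
  classical
  induction h using Polynomial.induction_on' with
  | add p q hp hq => simp [hp, hq]
  | monomial j q =>
    induction q using MvPolynomial.induction_on' with
    | monomial u a =>
      rw [vcaPhi_monomial, ← LaurentPolynomial.single_eq_C_mul_T, AddMonoidAlgebra.coeff_single,
        Finsupp.single_apply]
      by_cases hj : j = k
      · subst hj
        by_cases hu : u = b
        · subst hu; simp
        · split_ifs <;> simp [hu, MvPolynomial.coeff_monomial]
      · split_ifs <;> simp [hj, Polynomial.coeff_monomial]
    | add p q hp hq => simp [hp, hq]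

lemma vca_laurent_int {R : Type*} [CommRing R] [IsDomain R] [IsIntegrallyClosed (Polynomial R)]
    (y : R[T;T⁻¹]) (hy : IsIntegral (Polynomial R) y) : ∃ g : Polynomial R, g.toLaurent = y := by
  let F := FractionRing (Polynomial R)
  have hX : Submonoid.powers (Polynomial.X : Polynomial R) ≤ nonZeroDivisors _ :=
    powers_le_nonZeroDivisors_of_noZeroDivisors Polynomial.X_ne_zero
  let f : R[T;T⁻¹] →ₐ[Polynomial R] F :=
    IsLocalization.liftAlgHom (M := Submonoid.powers (Polynomial.X : Polynomial R))
      (f := Algebra.ofId (Polynomial R) F)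
      (fun z => IsLocalization.map_units F (⟨z.1, hX z.2⟩ : nonZeroDivisors (Polynomial R)))
  have hf : Function.Injective f := by
    have := (IsLocalization.lift_injective_iff (S := R[T;T⁻¹])
      (M := Submonoid.powers (Polynomial.X : Polynomial R)) (g := algebraMap (Polynomial R) F)
      (fun z => IsLocalization.map_units F (⟨z.1, hX z.2⟩ : nonZeroDivisors (Polynomial R)))).2
      (by
        intro a b
        rw [(IsFractionRing.injective (Polynomial R) F).eq_iff, algebraMap_eq_toLaurent,
          algebraMap_eq_toLaurent, Polynomial.toLaurent_inj])
    exact this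
  have h1 : IsIntegrallyClosedIn (Polynomial R) R[T;T⁻¹] :=
    AlgHom.isIntegrallyClosedIn f hf inferInstance
  exact IsIntegrallyClosedIn.algebraMap_eq_of_integral hy

lemma vca_int_transfer {A B L P : Type*} [CommRing A] [CommRing B] [CommRing L] [CommRing P]
    [Algebra A B] [Algebra P L] (φ : B →+* L)
    (hA : ∀ a : A, ∃ g : P, algebraMap P L g = φ (algebraMap A B a))
    (h : B) (hh : IsIntegral A h) : IsIntegral P (φ h) := by
  obtain ⟨p, hp, hp0⟩ := hh
  have h3 : IsIntegral (algebraMap P L).range (φ h) := by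
    let ψ : A →+* (algebraMap P L).range :=
      (φ.comp (algebraMap A B)).codRestrict _ (fun a => hA a)
    refine ⟨p.map ψ, hp.map _, ?_⟩
    rw [Polynomial.eval₂_map, ← map_zero φ, ← hp0, Polynomial.hom_eval₂]
    rfl
  obtain ⟨q, hq, hq0⟩ := h3
  obtain ⟨q', hq', -, hq'm⟩ := Polynomial.lifts_and_natDegree_eq_and_monic
    (f := (algebraMap P L).rangeRestrict) (p := q)
    ((Polynomial.mem_lifts _).2
      (Polynomial.map_surjective _ (RingHom.rangeRestrict_surjective _) q)) hq
  refine ⟨q', hq'm, ?_⟩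
  rw [← hq', Polynomial.eval₂_map] at hq0
  exact hq0

lemma vca_weight_nonneg {n : ℕ} {K : Type*} [Field K] {B : Type*} [CommRing B]
    [IsDomain B] [IsIntegrallyClosed (Polynomial B)]
    (e : Polynomial (MvPolynomial (Fin n) K) ≃+* B) (w : Fin n → ℤ) (w0 : ℤ)
    (s : Set (Polynomial (MvPolynomial (Fin n) K)))
    (hs : ∀ f ∈ s, ∃ g : Polynomial B,
      g.toLaurent = vcaPhi e w w0 f)
    (h : Polynomial (MvPolynomial (Fin n) K)) (hh : IsIntegral (Algebra.adjoin K s) h)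
    (b : Fin n →₀ ℕ) (k : ℕ) (hc : MvPolynomial.coeff b (h.coeff k) ≠ 0) :
    0 ≤ vcaWeight w w0 b k := by
  set A := Algebra.adjoin K s
  have hA : ∀ f ∈ A, ∃ g : Polynomial B,
      g.toLaurent = vcaPhi e w w0 f := by
    intro f hf
    induction hf using Algebra.adjoin_induction with
    | mem x hx => exact hs x hx
    | algebraMap r =>
      refine ⟨Polynomial.C (e (Polynomial.C (MvPolynomial.C r))), ?_⟩
      have := vcaPhi_monomial e w w0 0 0 r
      simp [vcaWeight] at this
      simpa using this.symm
    | add x y _ _ hx hy =>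
      obtain ⟨g1, h1⟩ := hx
      obtain ⟨g2, h2⟩ := hy
      exact ⟨g1 + g2, by rw [map_add, map_add, h1, h2]⟩
    | mul x y _ _ hx hy =>
      obtain ⟨g1, h1⟩ := hx
      obtain ⟨g2, h2⟩ := hy
      exact ⟨g1 * g2, by rw [map_mul, map_mul, h1, h2]⟩
  have hint : IsIntegral (Polynomial B) (vcaPhi e w w0 h) :=
    vca_int_transfer (A := A) (vcaPhi e w w0) (fun a => hA a a.2) h hh
  obtain ⟨g, hg⟩ := vca_laurent_int _ hint
  by_contra hneg
  apply hc
  rw [← vcaPhi_coeff e w w0, ← hg]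
  have : (g.toLaurent).coeff (vcaWeight w w0 b k) = 0 := by
    by_contra h0
    have := Finsupp.mem_support_iff.2 h0
    rw [LaurentPolynomial.support_coeff_toLaurent] at this
    simp at this
    obtain ⟨m, _, hm⟩ := this
    omega
  rw [this]; simp

instance vcaInst (n : ℕ) (K : Type*) [Field K] :
  IsIntegrallyClosed (Polynomial (Polynomial (MvPolynomial (Fin n) K))) := inferInstance
end VCA

section VCF
open LaurentPolynomial

/-- exponent vector of the squarefree monomial `x_C` -/
noncomputable def vcfInd {n : ℕ} (C : Finset (Fin n)) : Fin n →₀ ℕ :=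
  Finsupp.equivFunOnFinite.symm (fun i => if i ∈ C then 1 else 0)

lemma vcf_prod {n : ℕ} (K : Type*) [Field K] (b : Fin n →₀ ℕ) (c : K) :
    MvPolynomial.monomial b c = MvPolynomial.C c * ∏ i, (MvPolynomial.X i) ^ b i := by
  rw [MvPolynomial.monomial_eq, Finsupp.prod_fintype _ _ (by simp)]

lemma vcf_gen {n : ℕ} (K : Type*) [Field K] (C : Finset (Fin n)) :
    Polynomial.C (∏ i ∈ C, (MvPolynomial.X i : MvPolynomial (Fin n) K)) * Polynomial.X =
      Polynomial.monomial 1 (MvPolynomial.monomial (vcfInd C) (1 : K)) := by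
  rw [vcf_prod, ← Polynomial.C_mul_X_pow_eq_monomial, pow_one]
  congr 2
  simp [vcfInd, Finset.prod_ite_mem]

lemma vcf_range {n : ℕ} (K : Type*) [Field K] (w : Fin n → ℤ) (w0 : ℤ) (C : Finset (Fin n))
    (hw : 0 ≤ ∑ i ∈ C, w i + w0) :
    ∃ g : Polynomial (Polynomial (MvPolynomial (Fin n) K)),
      g.toLaurent = vcaPhi (RingEquiv.refl _) w w0
        (Polynomial.C (∏ i ∈ C, (MvPolynomial.X i : MvPolynomial (Fin n) K)) * Polynomial.X) := by
  rw [vcf_gen, vcaPhi_monomial]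
  have hl : vcaWeight w w0 (vcfInd C) 1 = ∑ i ∈ C, w i + w0 := by
    simp [vcaWeight, vcfInd, Finset.sum_ite_mem]
  rw [hl]
  obtain ⟨m, hm⟩ := Int.eq_ofNat_of_zero_le hw
  rw [hm]
  exact ⟨_, Polynomial.toLaurent_C_mul_X_pow _ _⟩

lemma vcf_mem {n : ℕ} (K : Type*) [Field K] (S : Subalgebra K (Polynomial (MvPolynomial (Fin n) K)))
    (b : Fin n →₀ ℕ) (k : ℕ) (c : K) (D : ℕ → Finset (Fin n))
    (hD : ∀ j < k, Polynomial.C (∏ i ∈ D j, (MvPolynomial.X i : MvPolynomial (Fin n) K)) *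
      Polynomial.X ∈ S)
    (hb : ∀ i, ((Finset.range k).filter (fun j => i ∈ D j)).card = b i) :
    Polynomial.monomial k (MvPolynomial.monomial b c) ∈ S := by
  have h1 : ∏ j ∈ Finset.range k,
      (Polynomial.C (∏ i ∈ D j, (MvPolynomial.X i : MvPolynomial (Fin n) K)) * Polynomial.X) ∈ S :=
    prod_mem (fun j hj => hD j (Finset.mem_range.1 hj))
  have h2 : Polynomial.monomial k (MvPolynomial.monomial b c) = c • ∏ j ∈ Finset.range k,
      (Polynomial.C (∏ i ∈ D j, (MvPolynomial.X i : MvPolynomial (Fin n) K)) * Polynomial.X) := by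
    rw [Finset.prod_mul_distrib, Finset.prod_const, Finset.card_range, ← map_prod]
    have h3 : ∏ j ∈ Finset.range k, ∏ i ∈ D j, (MvPolynomial.X i : MvPolynomial (Fin n) K) =
        ∏ i, (MvPolynomial.X i) ^ b i := by
      have : ∀ j, ∏ i ∈ D j, (MvPolynomial.X i : MvPolynomial (Fin n) K) =
          ∏ i, if i ∈ D j then MvPolynomial.X i else 1 := fun j => by
        simp [Finset.prod_ite_mem]
      simp_rw [this]
      rw [Finset.prod_comm]
      refine Finset.prod_congr rfl fun i _ => ?_
      rw [← Finset.prod_filter, Finset.prod_const, hb]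
    rw [h3, vcf_prod, ← Polynomial.C_mul_X_pow_eq_monomial, ← smul_mul_assoc, Polynomial.smul_C,
      MvPolynomial.smul_eq_C_mul]
  rw [h2]
  exact S.smul_mem h1 c
end VCF

/-- let `G` be a proper interval graph on `[n]` and `K` a field.  Then the
vertex cover algebra of `G`, the `K`-subalgebra
`K[x_C t : C a minimal vertex cover of G]` of `K[x_1,…,x_n,t]`, is a normal domain, i.e. an
integral domain which is integrally closed in its field of fractions. -/
theorem vertex_cover_algebra_of_properInterval_normal_domain
    (n : ℕ) (K : Type*) [Field K] (G : SimpleGraph (Fin n)) (hG : IsProperInterval G)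
    (A : Subalgebra K (Polynomial (MvPolynomial (Fin n) K)))
    (hA : A = Algebra.adjoin K { f : Polynomial (MvPolynomial (Fin n) K) |
      ∃ C : Finset (Fin n), IsMinVertexCover G C ∧
        f = Polynomial.C (∏ i ∈ C, MvPolynomial.X i) * Polynomial.X }) :
    IsDomain A ∧ IsIntegrallyClosed A := by

  classical
  subst hA
  refine ⟨inferInstance, ?_⟩
  set s : Set (Polynomial (MvPolynomial (Fin n) K)) := { f | ∃ C : Finset (Fin n),
    IsMinVertexCover G C ∧ f = Polynomial.C (∏ i ∈ C, MvPolynomial.X i) * Polynomial.X } with hs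
  have key : ∀ (w : Fin n → ℤ) (w0 : ℤ),
      (∀ C, IsMinVertexCover G C → 0 ≤ ∑ i ∈ C, w i + w0) →
      ∀ h : Polynomial (MvPolynomial (Fin n) K), IsIntegral (Algebra.adjoin K s) h →
      ∀ b k, MvPolynomial.coeff b (h.coeff k) ≠ 0 → 0 ≤ vcaWeight w w0 b k := by
    intro w w0 hw h hh b k hc
    refine vca_weight_nonneg (RingEquiv.refl _) w w0 s ?_ h hh b k hc
    rintro f ⟨C, hC, rfl⟩
    exact vcf_range K w w0 C (hw C hC)
  have main : ∀ h : Polynomial (MvPolynomial (Fin n) K), IsIntegral (Algebra.adjoin K s) h →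
      h ∈ Algebra.adjoin K s := by
    intro h hh
    rw [h.as_sum_support]
    refine sum_mem fun k _ => ?_
    rw [(h.coeff k).as_sum, map_sum]
    refine sum_mem fun b hb => ?_
    have hc := MvPolynomial.mem_support_iff.1 hb
    have g1 : ∀ i, b i ≤ k := by
      intro i
      have := key (fun j => if j = i then -1 else 0) 1 (by
        intro C _
        rw [Finset.sum_ite_eq']
        split_ifs <;> simp) h hh b k hc
      simp [vcaWeight] at this
      omega
    have hcast : ∀ Q : Finset (Fin n), ((∑ i ∈ Q, (k - b i) : ℕ) : ℤ) =
        k * Q.card - ∑ i ∈ Q, (b i : ℤ) := by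
      intro Q
      push_cast [Nat.cast_sub (g1 _)]
      rw [Finset.sum_sub_distrib]
      simp [mul_comm]
    have hwt : ∀ (Q : Finset (Fin n)) (ε w0 : ℤ), vcaWeight (fun j => if j ∈ Q then ε else 0) w0 b k
        = ε * ∑ i ∈ Q, (b i : ℤ) + k * w0 := by
      intro Q ε w0
      simp only [vcaWeight, mul_ite, mul_zero, Finset.sum_ite_mem, Finset.univ_inter]
      rw [← Finset.sum_mul, mul_comm]
    have hsC : ∀ (Q C : Finset (Fin n)) (ε : ℤ), (∑ i ∈ C, if i ∈ Q then ε else 0) =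
        ε * (Q.card - (Q \ C).card) := by
      intro Q C ε
      rw [Finset.sum_ite_mem, Finset.sum_const, Finset.inter_comm]
      have := Finset.card_sdiff_add_card_inter Q C
      have h' : ((Q ∩ C).card : ℤ) = Q.card - (Q \ C).card := by omega
      rw [nsmul_eq_mul, mul_comm]
      exact congrArg _ h'
    obtain ⟨D, hD1, hD2⟩ := vcc_decomp G hG (fun i => k - b i) k (by
      intro Q hQ
      have := key (fun j => if j ∈ Q then 1 else 0) (1 - Q.card) (by
        intro C hC
        have h1 := vcc_clique G C hC.1 Q hQ
        rw [hsC]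
        omega) h hh b k hc
      rw [hwt] at this
      have h2 := hcast Q
      zify
      push_cast at h2 ⊢
      rw [h2]
      linarith) (by
      intro z N hN
      have := key (fun j => if j ∈ N then -1 else 0) (N.card - 1) (by
        intro C hC
        obtain ⟨i, hi, hiC⟩ := vcc_min G C hC z
        have h1 : 0 < (N \ C).card :=
          Finset.card_pos.2 ⟨i, Finset.mem_sdiff.2 ⟨(hN i).2 hi, hiC⟩⟩
        rw [hsC]
        omega) h hh b k hc
      rw [hwt] at this
      have h2 := hcast N
      zify
      push_cast at h2 ⊢
      rw [h2]
      linarith)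
    refine vcf_mem K _ b k _ D (fun j hj => Algebra.subset_adjoin ⟨D j, hD1 j hj, rfl⟩) ?_
    intro i
    have := hD2 i
    have := g1 i
    omega
  have : IsIntegrallyClosedIn (Algebra.adjoin K s) (Polynomial (MvPolynomial (Fin n) K)) :=
    Subring.isIntegrallyClosedIn_iff.2 main
  exact IsIntegrallyClosed.of_isIntegrallyClosed_of_isIntegrallyClosedIn
    (Algebra.adjoin K s) (Polynomial (MvPolynomial (Fin n) K))
end

section
/- Let G be a proper interval graph on vertex set [n] = {1,…,n} with minimal vertex covers C_1,…,C_q, let K be a field, and let φ : K[y_1,…,y_q] → K[x_1,…,x_n,t] be the K-algebra homomorphism with φ(y_j) = x_{C_j} t. Then the kernel of φ is generated, as an ideal, by the quadratic binomials y_a y_b − y_c y_d over all pairs (x_{C_a}, x_{C_b}) that are unsorted with sort(x_{C_a}, x_{C_b}) = (x_{C_c}, x_{C_d}). -/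
open MvPolynomial

/-- Number of elements of `u` with index less than `k`. -/
def cnt {n : ℕ} (u : Multiset (Fin n)) (k : ℕ) : ℕ := u.countP (fun x => x.val < k)

lemma cnt_add {n : ℕ} (u v : Multiset (Fin n)) (k : ℕ) : cnt (u + v) k = cnt u k + cnt v k := by
  simp [cnt]

lemma cnt_zero {n : ℕ} (u : Multiset (Fin n)) : cnt u 0 = 0 := by
  simp [cnt]

lemma cnt_succ {n : ℕ} (u : Multiset (Fin n)) (k : Fin n) :
    cnt u (k.val + 1) = cnt u k.val + u.count k := by
  induction u using Multiset.induction_on with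
  | empty => simp [cnt]
  | cons a u ih =>
    simp only [cnt, Multiset.countP_cons, Multiset.count_cons] at ih ⊢
    have : k = a ↔ k.val = a.val := Fin.ext_iff
    split_ifs <;> omega

lemma cnt_ext {n : ℕ} {u v : Multiset (Fin n)} (h : ∀ k, k ≤ n → cnt u k = cnt v k) : u = v := by
  ext a
  have h1 := cnt_succ u a
  have h2 := cnt_succ v a
  have h3 := h a.val a.2.le
  have h4 := h (a.val + 1) a.2
  omega

lemma altSplit_cnt {n : ℕ} (l : List (Fin n)) (hl : l.Pairwise (· ≤ ·)) (k : ℕ) :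
    cnt ((altSplit l).1 : Multiset (Fin n)) k = (cnt (l : Multiset (Fin n)) k + 1) / 2 ∧
    cnt ((altSplit l).2 : Multiset (Fin n)) k = (cnt (l : Multiset (Fin n)) k) / 2 := by
  induction l with
  | nil => simp [altSplit, cnt]
  | cons a l ih =>
    obtain ⟨ha, hl'⟩ := List.pairwise_cons.1 hl
    obtain ⟨h1, h2⟩ := ih hl'
    simp only [altSplit, ← Multiset.cons_coe]
    by_cases hk : a.val < k
    · have e : ∀ u : Multiset (Fin n), cnt (a ::ₘ u) k = cnt u k + 1 := by
        intro u; simp [cnt, hk]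
      rw [e, e, h1, h2]; omega
    · have e : ∀ u : Multiset (Fin n), cnt (a ::ₘ u) k = cnt u k := by
        intro u; simp [cnt, hk]
      have z : cnt (l : Multiset (Fin n)) k = 0 := by
        simp only [cnt, Multiset.countP_eq_zero]
        intro x hx
        have := ha x (by simpa using hx)
        have : a.val ≤ x.val := this
        omega
      rw [e, e, h1, h2, z]; omega

lemma sortPair_cnt {n : ℕ} (u v : Multiset (Fin n)) (k : ℕ) :
    cnt (sortPair u v).1 k = (cnt u k + cnt v k + 1) / 2 ∧
    cnt (sortPair u v).2 k = (cnt u k + cnt v k) / 2 := by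
  have := altSplit_cnt ((u + v).sort (· ≤ ·)) (Multiset.pairwise_sort _ _) k
  rw [Multiset.sort_eq, cnt_add] at this
  exact this

lemma sortPair_add {n : ℕ} (u v : Multiset (Fin n)) :
    (sortPair u v).1 + (sortPair u v).2 = u + v := by
  apply cnt_ext
  intro k _
  rw [cnt_add, cnt_add, (sortPair_cnt u v k).1, (sortPair_cnt u v k).2]; omega

lemma cnt_interval {n : ℕ} (D : Finset (Fin n)) (p q : ℕ) (h : p ≤ q) :
    cnt D.val q = cnt D.val p + (D.filter (fun x => p ≤ x.val ∧ x.val < q)).card := by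
  have e : ∀ k, cnt D.val k = (D.filter (fun x => x.val < k)).card := by
    intro k; simp [cnt, Multiset.countP_eq_card_filter, Finset.card_def]
  rw [e, e, ← Finset.card_union_of_disjoint]
  · congr 1; ext x; simp only [Finset.mem_filter, Finset.mem_union]
    constructor
    · rintro ⟨a, b⟩
      by_cases hx : x.val < p
      · exact Or.inl ⟨a, hx⟩
      · exact Or.inr ⟨a, by omega, b⟩
    · rintro (⟨a, b⟩ | ⟨a, b, c⟩)
      · exact ⟨a, by omega⟩
      · exact ⟨a, c⟩
  · rw [Finset.disjoint_left]; intro x; simp only [Finset.mem_filter]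
    rintro ⟨_, _⟩ ⟨_, _, _⟩; omega

lemma cnt_compl {n : ℕ} (D : Finset (Fin n)) (k : ℕ) (hk : k ≤ n) :
    cnt D.val k + cnt (Dᶜ).val k = k := by
  induction k with
  | zero => simp [cnt_zero]
  | succ k ih =>
    have h1 := cnt_succ D.val ⟨k, hk⟩
    have h2 := cnt_succ (Dᶜ).val ⟨k, hk⟩
    have h3 := ih (by omega)
    have h4 : D.val.count ⟨k, hk⟩ + (Dᶜ).val.count ⟨k, hk⟩ = 1 := by
      rw [Multiset.count_eq_of_nodup D.nodup, Multiset.count_eq_of_nodup (Dᶜ).nodup]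
      by_cases h : (⟨k, hk⟩ : Fin n) ∈ D <;> simp [h]
    simp only at h1 h2
    omega

lemma miss_le_one {n : ℕ} (D : Finset (Fin n)) (i j : Fin n) (hij : i ≤ j) :
    cnt D.val i + (j.val - i.val) ≤ cnt D.val (j + 1) ↔
      ∀ a b : Fin n, i ≤ a → a ≤ j → i ≤ b → b ≤ j → a ≠ b → a ∈ D ∨ b ∈ D := by
  have hij' : i.val ≤ j.val := hij
  have h1 := cnt_compl D i i.2.le
  have h2 := cnt_compl D (j + 1) j.2
  have h3 := cnt_interval Dᶜ i (j + 1) (by omega)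
  have h4 : cnt D.val i + (j.val - i.val) ≤ cnt D.val (j + 1) ↔
    ((Dᶜ).filter (fun x => i.val ≤ x.val ∧ x.val < j.val + 1)).card ≤ 1 := by omega
  rw [h4, Finset.card_le_one]
  simp only [Finset.mem_filter, Finset.mem_compl, Fin.le_def]
  constructor
  · intro h a b h1 h2 h3 h4 h5
    by_contra hc
    push Not at hc
    exact h5 (h a ⟨hc.1, h1, by omega⟩ b ⟨hc.2, h3, by omega⟩)
  · rintro h a ⟨ha, h1, h2⟩ b ⟨hb, h3, h4⟩
    by_contra hc
    have := h a b h1 (by omega) h3 (by omega) hc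
    tauto

lemma miss_pos {n : ℕ} (D : Finset (Fin n)) (i j : Fin n) (hij : i ≤ j) :
    cnt D.val (j + 1) ≤ cnt D.val i + (j.val - i.val) ↔
      ∃ a : Fin n, i ≤ a ∧ a ≤ j ∧ a ∉ D := by
  have hij' : i.val ≤ j.val := hij
  have h1 := cnt_compl D i i.2.le
  have h2 := cnt_compl D (j + 1) j.2
  have h3 := cnt_interval Dᶜ i (j + 1) (by omega)
  have h4 : cnt D.val (j + 1) ≤ cnt D.val i + (j.val - i.val) ↔
    0 < ((Dᶜ).filter (fun x => i.val ≤ x.val ∧ x.val < j.val + 1)).card := by omega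
  rw [h4, Finset.card_pos]
  constructor
  · rintro ⟨a, ha⟩
    simp only [Finset.mem_filter, Finset.mem_compl] at ha
    exact ⟨a, ha.2.1, Fin.le_def.2 (by omega), ha.1⟩
  · rintro ⟨a, h1, h2, h3⟩
    refine ⟨a, ?_⟩
    simp only [Finset.mem_filter, Finset.mem_compl]
    have : a.val ≤ j.val := h2
    exact ⟨h3, h1, by omega⟩

lemma cover_iff {n : ℕ} {G : SimpleGraph (Fin n)} (hG : IsProperInterval G)
    (D : Finset (Fin n)) : IsVertexCover G D ↔
      ∀ i j : Fin n, i < j → G.Adj i j → cnt D.val i + (j.val - i.val) ≤ cnt D.val (j + 1) := by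
  constructor
  · intro h i j hij hadj
    rw [miss_le_one D i j hij.le]
    intro a b h1 h2 h3 h4 h5
    exact h a b (hG i j hij hadj a b h1 h2 h3 h4 h5)
  · intro h a b hab
    rcases lt_trichotomy a b with hl | hl | hl
    · exact (miss_le_one D a b hl.le).1 (h a b hl hab) a b le_rfl hl.le hl.le le_rfl hl.ne
    · exact absurd hl hab.ne
    · exact (miss_le_one D b a hl.le).1 (h b a hl hab.symm) a b hl.le le_rfl le_rfl hl.le hl.ne'

lemma nbhd_interval {n : ℕ} {G : SimpleGraph (Fin n)} (hG : IsProperInterval G) (v : Fin n) :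
    ∃ l r : Fin n, l ≤ r ∧ ∀ w, (w = v ∨ G.Adj v w) ↔ (l ≤ w ∧ w ≤ r) := by
  classical
  let s : Finset (Fin n) := Finset.univ.filter (fun w => w = v ∨ G.Adj v w)
  have hs : s.Nonempty := ⟨v, by simp [s]⟩
  have hv : v ∈ s := by simp [s]
  have hmem : ∀ w, w ∈ s ↔ (w = v ∨ G.Adj v w) := by intro w; simp [s]
  refine ⟨s.min' hs, s.max' hs, Finset.min'_le _ _ (Finset.max'_mem s hs), ?_⟩
  intro w
  rw [← hmem]
  refine ⟨fun h => ⟨Finset.min'_le _ _ h, Finset.le_max' _ _ h⟩, ?_⟩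
  rintro ⟨h1, h2⟩
  rcases lt_trichotomy w v with hl | hl | hl
  · have hm := (hmem _).1 (Finset.min'_mem s hs)
    have hlt : s.min' hs < v := lt_of_le_of_lt h1 hl
    rcases hm with hm | hm
    · exact absurd hm hlt.ne
    · exact (hmem w).2 (Or.inr (hG _ v hlt hm.symm v w hlt.le le_rfl h1 hl.le hl.ne'))
  · rw [hl]; exact hv
  · have hm := (hmem _).1 (Finset.max'_mem s hs)
    have hlt : v < s.max' hs := lt_of_lt_of_le hl h2
    rcases hm with hm | hm
    · exact absurd hm hlt.ne'
    · exact (hmem w).2 (Or.inr (hG v _ hlt hm v w le_rfl hlt.le hl.le h2 hl.ne))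

lemma minCover_iff {n : ℕ} {G : SimpleGraph (Fin n)} (D : Finset (Fin n)) :
    IsMinVertexCover G D ↔ IsVertexCover G D ∧ ∀ v, ∃ w, (w = v ∨ G.Adj v w) ∧ w ∉ D := by
  constructor
  · rintro ⟨h1, h2⟩
    refine ⟨h1, fun v => ?_⟩
    by_contra hc
    push Not at hc
    have hv : v ∈ D := hc v (Or.inl rfl)
    have : D.erase v = D := by
      apply h2 _ (Finset.erase_subset _ _)
      intro a b hab
      simp only [Finset.mem_erase]
      by_cases ha : a = v
      · subst ha
        exact Or.inr ⟨hab.ne', hc b (Or.inr hab)⟩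
      · by_cases hb : b = v
        · subst hb
          exact Or.inl ⟨ha, hc a (Or.inr hab.symm)⟩
        · have := h1 a b hab
          tauto
    rw [← this] at hv
    simp at hv
  · rintro ⟨h1, h2⟩
    refine ⟨h1, fun E hE hcov => Finset.Subset.antisymm hE ?_⟩
    intro v hv
    obtain ⟨w, hw, hwD⟩ := h2 v
    rcases hw with rfl | hw
    · exact absurd hv hwD
    · rcases hcov v w hw with h | h
      · exact h
      · exact absurd (hE h) hwD

/-- Sortability of the minimal vertex covers. -/
lemma sortable {n : ℕ} {G : SimpleGraph (Fin n)} (hG : IsProperInterval G)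
    {A B : Finset (Fin n)} (hA : IsMinVertexCover G A) (hB : IsMinVertexCover G B) :
    ∃ U V : Finset (Fin n), IsMinVertexCover G U ∧ IsMinVertexCover G V ∧
      sortPair A.val B.val = (U.val, V.val) := by
  have hc := sortPair_cnt A.val B.val
  have hn : ∀ k, A.val.count k ≤ 1 ∧ B.val.count k ≤ 1 := fun k =>
    ⟨Multiset.nodup_iff_count_le_one.1 A.nodup k, Multiset.nodup_iff_count_le_one.1 B.nodup k⟩
  have n1 : (sortPair A.val B.val).1.Nodup := by
    rw [Multiset.nodup_iff_count_le_one]; intro k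
    have := cnt_succ (sortPair A.val B.val).1 k
    have := cnt_succ A.val k
    have := cnt_succ B.val k
    have := (hc k).1
    have := (hc (k+1)).1
    have := hn k
    omega
  have n2 : (sortPair A.val B.val).2.Nodup := by
    rw [Multiset.nodup_iff_count_le_one]; intro k
    have := cnt_succ (sortPair A.val B.val).2 k
    have := cnt_succ A.val k
    have := cnt_succ B.val k
    have := (hc k).2
    have := (hc (k+1)).2
    have := hn k
    omega
  obtain ⟨hA1, hA2⟩ := (minCover_iff A).1 hA
  obtain ⟨hB1, hB2⟩ := (minCover_iff B).1 hB
  rw [cover_iff hG] at hA1 hB1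
  refine ⟨⟨_, n1⟩, ⟨_, n2⟩, (minCover_iff _).2 ⟨(cover_iff hG _).2 ?_, ?_⟩,
    (minCover_iff _).2 ⟨(cover_iff hG _).2 ?_, ?_⟩, rfl⟩
  · intro i j hij hadj
    have := hA1 i j hij hadj
    have := hB1 i j hij hadj
    have := (hc i).1
    have := (hc (j+1)).1
    simp only
    omega
  · intro v
    obtain ⟨l, r, hlr, hw⟩ := nbhd_interval hG v
    have ha := hA2 v
    have hb := hB2 v
    simp only [hw, and_assoc] at ha hb ⊢
    rw [← miss_pos _ l r hlr] at ha hb ⊢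
    have := (hc l).1
    have := (hc (r+1)).1
    simp only
    omega
  · intro i j hij hadj
    have := hA1 i j hij hadj
    have := hB1 i j hij hadj
    have := (hc i).2
    have := (hc (j+1)).2
    simp only
    omega
  · intro v
    obtain ⟨l, r, hlr, hw⟩ := nbhd_interval hG v
    have ha := hA2 v
    have hb := hB2 v
    simp only [hw, and_assoc] at ha hb ⊢
    rw [← miss_pos _ l r hlr] at ha hb ⊢
    have := (hc l).2
    have := (hc (r+1)).2
    simp only
    omega

lemma split_two {m : ℕ} {M : Type*} [CommMonoid M] (h : Fin m → M) {i j : Fin m} (hij : i ≠ j) :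
    ∏ x, h x = h i * h j * ∏ x ∈ (Finset.univ.erase i).erase j, h x := by
  rw [← Finset.mul_prod_erase Finset.univ h (Finset.mem_univ i),
    ← Finset.mul_prod_erase (Finset.univ.erase i) h (a := j) (by simp [hij.symm]), mul_assoc]

lemma split_two_add {m : ℕ} {M : Type*} [AddCommMonoid M] (h : Fin m → M) {i j : Fin m}
    (hij : i ≠ j) :
    ∑ x, h x = h i + h j + ∑ x ∈ (Finset.univ.erase i).erase j, h x := by
  rw [← Finset.add_sum_erase Finset.univ h (Finset.mem_univ i),
    ← Finset.add_sum_erase (Finset.univ.erase i) h (a := j) (by simp [hij.symm]), add_assoc]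

/-- Replace the entries at `i` and `j`. -/
def upd2 {m : ℕ} {β : Type*} (f : Fin m → β) (i j : Fin m) (c d : β) : Fin m → β :=
  Function.update (Function.update f i c) j d

lemma upd2_i {m : ℕ} {β : Type*} (f : Fin m → β) {i j : Fin m} (hij : i ≠ j) (c d : β) :
    upd2 f i j c d i = c := by simp [upd2, hij]

lemma upd2_j {m : ℕ} {β : Type*} (f : Fin m → β) {i j : Fin m} (c d : β) :
    upd2 f i j c d j = d := by simp [upd2]

lemma upd2_other {m : ℕ} {β : Type*} (f : Fin m → β) {i j x : Fin m} (c d : β) (hi : x ≠ i)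
    (hj : x ≠ j) : upd2 f i j c d x = f x := by simp [upd2, hi, hj]

lemma sq_aux (m i j x y x' y' : ℤ) (hi : i < j) (hj : j - i < m) (hs : x' + y' = x + y)
    (h0 : y' ≤ x') (h1 : x' ≤ y' + 1) :
    (m * x' + i) ^ 2 + (m * y' + j) ^ 2 ≤ (m * x + i) ^ 2 + (m * y + j) ^ 2 ∧
    (¬ (y ≤ x ∧ x ≤ y + 1) →
      (m * x' + i) ^ 2 + (m * y' + j) ^ 2 < (m * x + i) ^ 2 + (m * y + j) ^ 2) := by
  have strict : ¬ (y ≤ x ∧ x ≤ y + 1) →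
      (m * x' + i) ^ 2 + (m * y' + j) ^ 2 < (m * x + i) ^ 2 + (m * y + j) ^ 2 := by
    intro hn
    obtain ⟨e, he⟩ : ∃ e, e = j - i := ⟨_, rfl⟩
    have hje : j = i + e := by omega
    subst hje
    have key : (m * (x' - y') - e) ^ 2 < (m * (x - y) - e) ^ 2 := by
      rw [sq_lt_sq]
      have hL : |m * (x' - y') - e| < m + e ∧ |m * (x' - y') - e| < 2 * m - e := by
        have : x' - y' = 0 ∨ x' - y' = 1 := by omega
        constructor <;> rw [abs_lt] <;> rcases this with h | h <;> rw [h] <;> constructor <;>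
          linarith
      by_cases hd : 2 ≤ x - y
      · have : 2 * m - e ≤ m * (x - y) - e := by nlinarith
        exact lt_of_lt_of_le hL.2 (this.trans (le_abs_self _))
      · have hd' : x - y ≤ -1 := by omega
        have : m + e ≤ -(m * (x - y) - e) := by nlinarith
        exact lt_of_lt_of_le hL.1 (this.trans (neg_le_abs _))
    have hsum : m * x' + i + (m * y' + (i + e)) = m * x + i + (m * y + (i + e)) := by
      linear_combination m * hs
    have a1 : 2 * ((m * x' + i) ^ 2 + (m * y' + (i + e)) ^ 2) =
      (m * x' + i + (m * y' + (i + e))) ^ 2 + (m * (x' - y') - e) ^ 2 := by ring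
    have a2 : 2 * ((m * x + i) ^ 2 + (m * y + (i + e)) ^ 2) =
      (m * x + i + (m * y + (i + e))) ^ 2 + (m * (x - y) - e) ^ 2 := by ring
    rw [hsum] at a1
    linarith
  refine ⟨?_, strict⟩
  by_cases hn : y ≤ x ∧ x ≤ y + 1
  · have : x' = x := by omega
    have : y' = y := by omega
    subst_vars
    simp_all
  · exact (strict hn).le

/-- Potential function. -/
def pot {m : ℕ} {q : ℕ} (n : ℕ) (F : Fin q → ℕ → ℕ) (f : Fin m → Fin q) : ℕ :=
  ∑ k ∈ Finset.range (n + 1), ∑ i : Fin m, (m * F (f i) k + i.val) ^ 2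

lemma pot_lt {m n q : ℕ} (F : Fin q → ℕ → ℕ) (f : Fin m → Fin q) (i j : Fin m) (hij : i < j)
    (c d : Fin q) (h1 : ∀ k, F c k = (F (f i) k + F (f j) k + 1) / 2)
    (h2 : ∀ k, F d k = (F (f i) k + F (f j) k) / 2) (k : ℕ) (hk : k ≤ n)
    (hbad : ¬ (F (f j) k ≤ F (f i) k ∧ F (f i) k ≤ F (f j) k + 1)) :
    pot n F (upd2 f i j c d) < pot n F f := by
  have hne : i ≠ j := hij.ne
  have hij' : i.val < j.val := hij
  have hjm := j.2
  have aux : ∀ k, (∑ x : Fin m, (m * F (upd2 f i j c d x) k + x.val) ^ 2 ≤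
      ∑ x : Fin m, (m * F (f x) k + x.val) ^ 2) ∧
      (¬ (F (f j) k ≤ F (f i) k ∧ F (f i) k ≤ F (f j) k + 1) →
      ∑ x : Fin m, (m * F (upd2 f i j c d x) k + x.val) ^ 2 <
      ∑ x : Fin m, (m * F (f x) k + x.val) ^ 2) := by
    intro k
    rw [split_two_add _ hne, split_two_add (fun x : Fin m => (m * F (f x) k + x.val) ^ 2) hne]
    have e : ∑ x ∈ (Finset.univ.erase i).erase j, (m * F (upd2 f i j c d x) k + x.val) ^ 2 =
        ∑ x ∈ (Finset.univ.erase i).erase j, (m * F (f x) k + x.val) ^ 2 := by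
      apply Finset.sum_congr rfl
      intro x hx
      simp only [Finset.mem_erase, Finset.mem_univ, and_true] at hx
      rw [upd2_other f c d hx.2 hx.1]
    rw [e, upd2_i f hne, upd2_j]
    have h1k := h1 k
    have h2k := h2 k
    have := sq_aux m i j (F (f i) k) (F (f j) k) (F c k) (F d k) (by omega) (by omega) (by omega)
      (by omega) (by omega)
    norm_cast at this
    exact ⟨Nat.add_le_add_right this.1 _, fun h => Nat.add_lt_add_right (this.2 h) _⟩
  apply Finset.sum_lt_sum
  · intro k _; exact (aux k).1
  · exact ⟨k, Finset.mem_range.2 (by omega), (aux k).2 hbad⟩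

lemma sorted_unique {m : ℕ} (x y : Fin m → ℕ)
    (hx : ∀ i j, i < j → x j ≤ x i ∧ x i ≤ x j + 1)
    (hy : ∀ i j, i < j → y j ≤ y i ∧ y i ≤ y j + 1)
    (hs : ∑ i, x i = ∑ i, y i) (i : Fin m) : y i ≤ x i := by
  by_contra hc
  push Not at hc
  have : ∑ i, x i < ∑ i, y i := by
    apply Finset.sum_lt_sum
    · intro j _
      rcases lt_trichotomy i j with h | h | h
      · have := hx i j h; have := hy i j h; omega
      · subst h; omega
      · have := hx j i h; have := hy j i h; omega
    · exact ⟨i, Finset.mem_univ _, hc⟩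
  omega

/-- Every tuple is congruent to a sorted one. -/
lemma exists_sorted {m n q : ℕ} {M : Type*} [CommMonoid M] (F : Fin q → ℕ → ℕ) (y : Fin q → M)
    (hsort : ∀ a b k, k ≤ n → ¬ (F b k ≤ F a k ∧ F a k ≤ F b k + 1) →
      ∃ c d, (∀ k, F c k = (F a k + F b k + 1) / 2) ∧ (∀ k, F d k = (F a k + F b k) / 2) ∧
        y a * y b = y c * y d) (f : Fin m → Fin q) :
    ∃ g : Fin m → Fin q, ∏ i, y (f i) = ∏ i, y (g i) ∧
      (∀ k, ∑ i, F (f i) k = ∑ i, F (g i) k) ∧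
      ∀ k, k ≤ n → ∀ i j, i < j → F (g j) k ≤ F (g i) k ∧ F (g i) k ≤ F (g j) k + 1 := by
  induction hN : pot n F f using Nat.strong_induction_on generalizing f with
  | _ N ih =>
  by_cases hall : ∀ k, k ≤ n → ∀ i j, i < j → F (f j) k ≤ F (f i) k ∧ F (f i) k ≤ F (f j) k + 1
  · exact ⟨f, rfl, fun _ => rfl, hall⟩
  · rw [not_forall] at hall
    obtain ⟨k, hall⟩ := hall
    rw [Classical.not_imp, not_forall] at hall
    obtain ⟨hk, i, hall⟩ := hall
    rw [not_forall] at hall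
    obtain ⟨j, hall⟩ := hall
    rw [Classical.not_imp] at hall
    obtain ⟨hij, hbad⟩ := hall
    obtain ⟨c, d, hc, hd, hy⟩ := hsort (f i) (f j) k hk hbad
    have hlt := pot_lt (n := n) F f i j hij c d hc hd k hk hbad
    obtain ⟨g, hg1, hg2, hg3⟩ := ih _ (hN ▸ hlt) (upd2 f i j c d) rfl
    have hoth : ∀ x ∈ (Finset.univ.erase i).erase j, upd2 f i j c d x = f x := by
      intro x hx
      simp only [Finset.mem_erase, Finset.mem_univ, and_true] at hx
      exact upd2_other f c d hx.2 hx.1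
    refine ⟨g, ?_, ?_, hg3⟩
    · rw [← hg1, split_two _ hij.ne, split_two (fun x => y (upd2 f i j c d x)) hij.ne,
        upd2_i f hij.ne, upd2_j, hy]
      congr 1
      exact Finset.prod_congr rfl fun x hx => by rw [hoth x hx]
    · intro k
      rw [← hg2, split_two_add _ hij.ne, split_two_add (fun x => F (upd2 f i j c d x) k) hij.ne,
        upd2_i f hij.ne, upd2_j]
      congr 1
      · have := hc k; have := hd k; omega
      · exact Finset.sum_congr rfl fun x hx => by rw [hoth x hx]

lemma prod_eq_of_sum_eq {m n q : ℕ} {M : Type*} [CommMonoid M] (F : Fin q → ℕ → ℕ) (y : Fin q → M)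
    (hF : ∀ a b, (∀ k, k ≤ n → F a k = F b k) → a = b)
    (hsort : ∀ a b k, k ≤ n → ¬ (F b k ≤ F a k ∧ F a k ≤ F b k + 1) →
      ∃ c d, (∀ k, F c k = (F a k + F b k + 1) / 2) ∧ (∀ k, F d k = (F a k + F b k) / 2) ∧
        y a * y b = y c * y d) (f g : Fin m → Fin q)
    (h : ∀ k, ∑ i, F (f i) k = ∑ i, F (g i) k) : ∏ i, y (f i) = ∏ i, y (g i) := by
  obtain ⟨f', hf1, hf2, hf3⟩ := exists_sorted (n := n) F y hsort f
  obtain ⟨g', hg1, hg2, hg3⟩ := exists_sorted (n := n) F y hsort g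
  have : f' = g' := by
    funext i
    apply hF
    intro k hk
    have hs : ∑ i, F (f' i) k = ∑ i, F (g' i) k := by rw [← hf2, ← hg2, h]
    exact le_antisymm
      (sorted_unique (fun i => F (g' i) k) (fun i => F (f' i) k) (hg3 k hk) (hf3 k hk) hs.symm i)
      (sorted_unique (fun i => F (f' i) k) (fun i => F (g' i) k) (hf3 k hk) (hg3 k hk) hs i)
  rw [hf1, hg1, this]

lemma cnt_sum {n m : ℕ} (u : Fin m → Multiset (Fin n)) (k : ℕ) :
    cnt (∑ i, u i) k = ∑ i, cnt (u i) k := by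
  let c : Multiset (Fin n) →+ ℕ := ⟨⟨fun u => cnt u k, by simp [cnt]⟩, fun u v => cnt_add u v k⟩
  exact map_sum c u Finset.univ

lemma monomial_eq_prod {q : ℕ} {K : Type*} [Field K] (s : Fin q →₀ ℕ) :
    ∃ (m : ℕ) (f : Fin m → Fin q), (monomial s (1 : K)) = ∏ i, X (f i) := by
  refine ⟨(Finsupp.toMultiset s).toList.length, fun i => (Finsupp.toMultiset s).toList[i], ?_⟩
  have h1 := Fin.prod_univ_fun_getElem (Finsupp.toMultiset s).toList
    (fun j => (X j : MvPolynomial (Fin q) K))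
  have h2 : ((Finsupp.toMultiset s).toList.map (fun j => (X j : MvPolynomial (Fin q) K))).prod =
      ((Finsupp.toMultiset s).map (fun j => (X j : MvPolynomial (Fin q) K))).prod := by
    conv_rhs => rw [← Multiset.coe_toList (Finsupp.toMultiset s)]
    rw [Multiset.map_coe, Multiset.prod_coe]
  refine Eq.trans ?_ (h2.symm.trans h1.symm)
  rw [Finsupp.toMultiset_map, Finsupp.prod_toMultiset, MvPolynomial.monomial_eq, C_1, one_mul,
    Finsupp.prod_mapDomain_index (by simp) (by intros; rw [pow_add])]

lemma prod_X_eq {n : ℕ} {K : Type*} [Field K] (D : Finset (Fin n)) :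
    (∏ i ∈ D, (X i : MvPolynomial (Fin n) K)) = monomial (Multiset.toFinsupp D.val) 1 := by
  have h : Multiset.toFinsupp D.val = ∑ i ∈ D, Finsupp.single i 1 := by
    ext a
    rw [Multiset.toFinsupp_apply, Multiset.count_eq_of_nodup D.nodup, Finsupp.finsetSum_apply]
    simp [Finsupp.single_apply]
  rw [h, monomial_sum_one]
  rfl


/-- let `G` be a proper interval graph on `[n]` with minimal vertex covers
`C_1, …, C_q`, `K` a field and `φ : K[y_1,…,y_q] → K[x_1,…,x_n,t]` the `K`-algebra map with
`φ(y_j) = x_{C_j} t`.  Then `ker φ` is generated by the binomials `y_a y_b − y_c y_d` over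
all unsorted pairs `(x_{C_a}, x_{C_b})` with `sort(x_{C_a}, x_{C_b}) = (x_{C_c}, x_{C_d})`. -/
theorem toric_ideal_of_cover_algebra_of_properInterval
    (n q : ℕ) (K : Type*) [Field K] (G : SimpleGraph (Fin n)) (hG : IsProperInterval G)
    (C : Fin q → Finset (Fin n)) (hinj : Function.Injective C)
    (hmin : ∀ j : Fin q, IsMinVertexCover G (C j))
    (hall : ∀ D : Finset (Fin n), IsMinVertexCover G D → ∃ j : Fin q, C j = D)
    (φ : MvPolynomial (Fin q) K →ₐ[K] Polynomial (MvPolynomial (Fin n) K))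
    (hφ : φ = MvPolynomial.aeval (fun j : Fin q =>
      Polynomial.C (∏ i ∈ C j, MvPolynomial.X i) * Polynomial.X)) :
    RingHom.ker φ =
      Ideal.span { f : MvPolynomial (Fin q) K |
        ∃ a b c d : Fin q, ¬ IsSortedPair (C a).val (C b).val ∧
          sortPair (C a).val (C b).val = ((C c).val, (C d).val) ∧
          f = X a * X b - X c * X d } := by
  classical
  set I := Ideal.span { f : MvPolynomial (Fin q) K |
        ∃ a b c d : Fin q, ¬ IsSortedPair (C a).val (C b).val ∧
          sortPair (C a).val (C b).val = ((C c).val, (C d).val) ∧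
          f = X a * X b - X c * X d } with hI
  have hφX : ∀ j, φ (X j) = Polynomial.C (monomial (Multiset.toFinsupp (C j).val) 1) *
      Polynomial.X := by
    intro j; rw [hφ, aeval_X, prod_X_eq]
  have hφprod : ∀ (m : ℕ) (f : Fin m → Fin q), φ (∏ i, X (f i)) =
      Polynomial.monomial m (monomial (Multiset.toFinsupp (∑ i, (C (f i)).val)) 1) := by
    intro m f
    rw [map_prod]
    simp only [hφX]
    rw [Finset.prod_mul_distrib, ← map_prod, map_sum, monomial_sum_one,
      ← Polynomial.C_mul_X_pow_eq_monomial]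
    simp
  apply le_antisymm
  · let mk : MvPolynomial (Fin q) K →ₐ[K] (MvPolynomial (Fin q) K ⧸ I) := Ideal.Quotient.mkₐ K I
    let F : Fin q → ℕ → ℕ := fun a k => cnt (C a).val k
    have hF : ∀ a b, (∀ k, k ≤ n → F a k = F b k) → a = b := by
      intro a b h
      exact hinj (Finset.val_injective (cnt_ext h))
    have hsort : ∀ a b k, k ≤ n → ¬ (F b k ≤ F a k ∧ F a k ≤ F b k + 1) →
      ∃ c d, (∀ k, F c k = (F a k + F b k + 1) / 2) ∧ (∀ k, F d k = (F a k + F b k) / 2) ∧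
        mk (X a) * mk (X b) = mk (X c) * mk (X d) := by
      intro a b k hk hbad
      obtain ⟨U, V, hU, hV, hUV⟩ := sortable hG (hmin a) (hmin b)
      obtain ⟨c, rfl⟩ := hall U hU
      obtain ⟨d, rfl⟩ := hall V hV
      have hc := sortPair_cnt (C a).val (C b).val
      have hc' := hc
      rw [hUV] at hc'
      refine ⟨c, d, fun k => (hc' k).1, fun k => (hc' k).2, ?_⟩
      rw [← map_mul, ← map_mul]
      apply (Ideal.Quotient.eq (I := I)).2
      apply Ideal.subset_span
      refine ⟨a, b, c, d, ?_, hUV, rfl⟩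
      intro hs
      rw [IsSortedPair] at hs
      rw [hs] at hc
      apply hbad
      have h1 : F a k = (F a k + F b k + 1) / 2 := (hc k).1
      have h2 : F b k = (F a k + F b k) / 2 := (hc k).2
      omega
    have key : ∀ (m : ℕ) (f g : Fin m → Fin q),
        ∑ i, (C (f i)).val = ∑ i, (C (g i)).val → ∏ i, mk (X (f i)) = ∏ i, mk (X (g i)) := by
      intro m f g h
      apply prod_eq_of_sum_eq (n := n) F (fun j => mk (X j)) hF hsort
      intro k
      simp only [F]
      rw [← cnt_sum, ← cnt_sum, h]
    let S : (m : ℕ) → (Fin n →₀ ℕ) → (MvPolynomial (Fin q) K ⧸ I) := fun m a =>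
      if h : ∃ f : Fin m → Fin q, Multiset.toFinsupp (∑ i, (C (f i)).val) = a then
        ∏ i, mk (X (h.choose i)) else 0
    have hS : ∀ (m : ℕ) (f : Fin m → Fin q),
        S m (Multiset.toFinsupp (∑ i, (C (f i)).val)) = ∏ i, mk (X (f i)) := by
      intro m f
      have h : ∃ g : Fin m → Fin q, Multiset.toFinsupp (∑ i, (C (g i)).val) =
        Multiset.toFinsupp (∑ i, (C (f i)).val) := ⟨f, rfl⟩
      simp only [S]
      rw [dif_pos h]
      exact key m _ _ (Multiset.toFinsupp.injective h.choose_spec)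
    let R : Polynomial (MvPolynomial (Fin n) K) →ₗ[K] (MvPolynomial (Fin q) K ⧸ I) :=
      Polynomial.lsum (fun m => (basisMonomials (Fin n) K).constr K (S m))
    have hR : ∀ m a, R (Polynomial.monomial m (monomial a 1)) = S m a := by
      intro m a
      simp only [R]
      rw [Polynomial.lsum_apply, Polynomial.sum_monomial_index _ _ (LinearMap.map_zero _)]
      have := (basisMonomials (Fin n) K).constr_basis K (S m) a
      rwa [coe_basisMonomials] at this
    have hcomp : R ∘ₗ φ.toLinearMap = mk.toLinearMap := by
      apply (basisMonomials (Fin q) K).ext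
      intro s
      rw [coe_basisMonomials]
      obtain ⟨m, f, hf⟩ := monomial_eq_prod (K := K) s
      simp only [LinearMap.comp_apply, AlgHom.toLinearMap_apply]
      rw [hf, hφprod, hR, hS, map_prod]
    intro p hp
    have hp' : φ p = 0 := hp
    have h := LinearMap.congr_fun hcomp p
    simp only [LinearMap.comp_apply, AlgHom.toLinearMap_apply, hp', map_zero] at h
    exact Ideal.Quotient.eq_zero_iff_mem.1 h.symm
  · rw [hI, Ideal.span_le]
    rintro _ ⟨a, b, c, d, -, hs, rfl⟩
    have hadd := sortPair_add (C a).val (C b).val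
    rw [hs] at hadd
    have e : ∀ a b, φ (X a * X b) =
        Polynomial.monomial 2 (monomial (Multiset.toFinsupp ((C a).val + (C b).val)) 1) := by
      intro a b
      have := hφprod 2 ![a, b]
      simpa [Fin.prod_univ_two, Fin.sum_univ_two] using this
    change φ (X a * X b - X c * X d) = 0
    rw [map_sub, e, e, ← hadd, sub_self]
end
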